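/- arXiv:1403.4126 — 12 statements merged into one kernel-verified Lean document; each statement's English description precedes it below -/
import Mathlib

section
/- (Dual Dubuc Adjoint Triangle Theorem) Let A, B, C be categories, let F : A → B be a functor with right adjoint U : B → A, and let K : C → A be a functor such that the composite F' = FK : C → B has a right adjoint. If C has equalisers of coreflexive pairs and F is of descent type, i.e. the comparison functor from A to the Eilenberg–Moore category B^{FU} of comodules over the comonad FU generated by the adjunction F ⊣ U is fully faithful, then K has a right adjoint. -/
open CategoryTheory Category Limits

/-- **dual Dubuc Adjoint Triangle Theorem.** Let `F : A ⥤ B` have a right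
adjoint `U`, and let `K : C ⥤ A` be such that `F' = FK : C ⥤ B` has a right adjoint. If
`C` has equalisers of coreflexive pairs and `F` is of descent type (the comparison functor
to the Eilenberg–Moore category of comodules over the comonad `FU` generated by the
adjunction `F ⊣ U` is fully faithful), then `K` has a right adjoint. -/
theorem dubuc_adjoint_triangle
    {A : Type*} {B : Type*} {C : Type*} [Category A] [Category B] [Category C]
    (F : A ⥤ B) (U : B ⥤ A) (adj : F ⊣ U) (K : C ⥤ A)
    [(K ⋙ F).IsLeftAdjoint]
    [HasCoreflexiveEqualizers C]
    [(Comonad.comparison adj).Full] [(Comonad.comparison adj).Faithful] :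
    K.IsLeftAdjoint := by
  let G := adj.toComonad
  let Φ := Comonad.comparison adj
  have : ((K ⋙ Φ) ⋙ G.forget).IsLeftAdjoint :=
    ((Adjunction.ofIsLeftAdjoint (K ⋙ F)).ofNatIsoLeft
      (Functor.isoWhiskerLeft K (Comonad.comparisonForget adj).symm)).isLeftAdjoint
  have : (K ⋙ Φ).IsLeftAdjoint :=
    isLeftAdjoint_triangle_lift (K ⋙ Φ) G.adj fun X => by
      simp only [Comonad.adj_unit]
      exact ⟨_, _, _, _, Comonad.beckCoalgebraEqualizer X⟩
  exact ((Adjunction.ofIsLeftAdjoint (K ⋙ Φ)).restrictFullyFaithful (R := Φ ⋙ _)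
    (.id C) (.ofFullyFaithful Φ) (Functor.leftUnitor _)
    (Functor.rightUnitor _).symm).isLeftAdjoint
end

section
/- Let G = (G, δ, ε) be a comonad on a category A, let F : B → A be a functor with right adjoint R (counit σ : FR → 1), and let K : B → A^G be a functor with U^G ∘ K = F, with induced left G-comodule structure α : F → GF and induced comonad morphism t_K = Gσ ∘ αR : FR → G. Then K is an equivalence of categories if and only if (i) the functor F is comonadic, and (ii) t_K is an isomorphism of comonads. -/
open CategoryTheory Category

/-- The functor `K : B ⥤ A^G` induced by a left `G`-comodule structure `α : F ⟶ GF` on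
`F : B ⥤ A`; on objects `K(b) = (F(b), α_b)`, and `U^G ∘ K = F`. -/
def comparisonToCoalgebras {A : Type*} {B : Type*} [Category A] [Category B]
    (G : Comonad A) (F : B ⥤ A) (α : F ⟶ F ⋙ (G : A ⥤ A))
    (hcounit : ∀ b : B, α.app b ≫ G.ε.app (F.obj b) = 𝟙 (F.obj b))
    (hcoassoc : ∀ b : B,
      α.app b ≫ G.δ.app (F.obj b) = α.app b ≫ (G : A ⥤ A).map (α.app b)) :
    B ⥤ G.Coalgebra where
  obj b :=
    { A := F.obj b
      a := α.app b
      counit := hcounit b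
      coassoc := hcoassoc b }
  map f :=
    { f := F.map f
      h := (α.naturality f).symm }

namespace CategoryTheory.Comonad

/-- Pushing coalgebras forward along a morphism of comonads. -/
@[simps]
def coalgebraFunctorOfComonadHom {A : Type*} [Category A] {M N : Comonad A} (t : M ⟶ N) :
    M.Coalgebra ⥤ N.Coalgebra where
  obj X :=
    { A := X.A
      a := X.a ≫ t.app X.A
      counit := by rw [assoc, t.app_ε, X.counit]
      coassoc := by
        rw [assoc, t.app_δ, X.coassoc_assoc, t.naturality_assoc, Functor.map_comp, assoc] }
  map {X Y} f :=
    { f := f.f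
      h := (assoc _ _ _).trans <| (congrArg (X.a ≫ ·) (t.naturality f.f).symm).trans <|
        (f.h_assoc _).trans rfl }

instance {A : Type*} [Category A] {M N : Comonad A} (t : M ⟶ N) :
    (coalgebraFunctorOfComonadHom t).Faithful where
  map_injective h := Coalgebra.Hom.ext (congrArg (forget N).map h)

/-- Pushing coalgebras forward along an invertible morphism of comonads is an equivalence. -/
theorem coalgebraFunctorOfComonadHom_isEquivalence {A : Type*} [Category A] {M N : Comonad A}
    (t : M ⟶ N) (ht : ∀ a, IsIso (t.app a)) :
    (coalgebraFunctorOfComonadHom t).IsEquivalence where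
  full :=
    { map_surjective := fun {X Y} f =>
        ⟨{ f := f.f
           h := by
            have h : (X.a ≫ t.app X.A) ≫ N.map f.f = f.f ≫ Y.a ≫ t.app Y.A := f.h
            refine (cancel_mono (t.app Y.A)).1 ?_
            exact (assoc _ _ _).trans <| (congrArg (X.a ≫ ·) (t.naturality f.f)).trans <|
              (assoc _ _ _).symm.trans <| h.trans (assoc _ _ _).symm }, rfl⟩ }
  essSurj :=
    { mem_essImage := fun Y =>
        ⟨{ A := Y.A
           a := Y.a ≫ inv (t.app Y.A)
           counit := by rw [← t.app_ε, assoc, IsIso.inv_hom_id_assoc, Y.counit]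
           coassoc := by
            rw [← cancel_mono (t.app (M.obj Y.A) ≫ N.map (t.app Y.A))]
            simp only [assoc]
            rw [← t.app_δ, IsIso.inv_hom_id_assoc, t.naturality_assoc,
              IsIso.inv_hom_id_assoc, ← N.map_comp, assoc, IsIso.inv_hom_id, comp_id,
              Y.coassoc] },
          ⟨Coalgebra.isoMk (Iso.refl Y.A) (by
            simp only [coalgebraFunctorOfComonadHom_obj_a, assoc, IsIso.inv_hom_id, comp_id]
            exact (congrArg (Y.a ≫ ·) (N.map_id _)).trans ((comp_id _).trans (id_comp _).symm))⟩⟩ }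

end CategoryTheory.Comonad

section

variable {A : Type*} {B : Type*} [Category A] [Category B]
  (G : Comonad A) {F : B ⥤ A} {R : A ⥤ B} (adj : F ⊣ R) (α : F ⟶ F ⋙ (G : A ⥤ A))

theorem map_unit_comp_coaction_comp_map_counit (b : B) :
    F.map (adj.unit.app b) ≫ α.app (R.obj (F.obj b)) ≫
      (G : A ⥤ A).map (adj.counit.app (F.obj b)) = α.app b := by
  have h := α.naturality (adj.unit.app b)
  dsimp at h
  rw [reassoc_of% h, ← G.map_comp, adj.left_triangle_components]
  exact (congrArg (α.app b ≫ ·) (G.map_id _)).trans (comp_id _)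

theorem coaction_comp_map_counit_comp_ε
    (hcounit : ∀ b : B, α.app b ≫ G.ε.app (F.obj b) = 𝟙 (F.obj b)) (a : A) :
    (α.app (R.obj a) ≫ (G : A ⥤ A).map (adj.counit.app a)) ≫ G.ε.app a =
      adj.counit.app a := by
  have h := Comonad.counit_naturality A G (adj.counit.app a)
  have h' := hcounit (R.obj a)
  rw [assoc]
  refine (congrArg (α.app (R.obj a) ≫ ·) h).trans ?_
  exact (reassoc_of% h') _

/-- The comonad morphism `t_K = Gσ ∘ αR : FR ⟶ G` induced by a coaction `α : F ⟶ GF`. -/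
def comonadHomOfCoaction
    (hcounit : ∀ b : B, α.app b ≫ G.ε.app (F.obj b) = 𝟙 (F.obj b))
    (hcoassoc : ∀ b : B,
      α.app b ≫ G.δ.app (F.obj b) = α.app b ≫ (G : A ⥤ A).map (α.app b)) : adj.toComonad ⟶ G where
  app a := α.app (R.obj a) ≫ (G : A ⥤ A).map (adj.counit.app a)
  naturality a a' f := by
    have h := α.naturality (R.map f)
    change F.map (R.map f) ≫ α.app (R.obj a') ≫ G.map (adj.counit.app a') =
      (α.app (R.obj a) ≫ G.map (adj.counit.app a)) ≫ G.map f
    dsimp at h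
    rw [reassoc_of% h, assoc, ← G.map_comp, ← G.map_comp]
    exact congrArg (fun k => α.app (R.obj a) ≫ G.map k) (adj.counit_naturality f)
  app_ε a := coaction_comp_map_counit_comp_ε G adj α hcounit a
  app_δ a := by
    have h := map_unit_comp_coaction_comp_map_counit G adj α (R.obj a)
    have h' := Comonad.delta_naturality A G (adj.counit.app a)
    change (α.app (R.obj a) ≫ G.map (adj.counit.app a)) ≫ G.δ.app a =
      F.map (adj.unit.app (R.obj a)) ≫
        (α.app (R.obj (F.obj (R.obj a))) ≫ G.map (adj.counit.app (F.obj (R.obj a)))) ≫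
        G.map (α.app (R.obj a) ≫ G.map (adj.counit.app a))
    dsimp at h h' ⊢
    simp only [assoc]
    rw [h', reassoc_of% (hcoassoc (R.obj a)), reassoc_of% h, G.map_comp]

/-- The functor `K` factors through the comparison functor of the adjunction. -/
def comparisonCompCoalgebraFunctorIso
    (hcounit : ∀ b : B, α.app b ≫ G.ε.app (F.obj b) = 𝟙 (F.obj b))
    (hcoassoc : ∀ b : B,
      α.app b ≫ G.δ.app (F.obj b) = α.app b ≫ (G : A ⥤ A).map (α.app b)) :
    Comonad.comparison adj ⋙ Comonad.coalgebraFunctorOfComonadHom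
        (comonadHomOfCoaction G adj α hcounit hcoassoc) ≅
      comparisonToCoalgebras G F α hcounit hcoassoc :=
  NatIso.ofComponents
    (fun b => Comonad.Coalgebra.isoMk (Iso.refl (F.obj b)) (by
      have h := map_unit_comp_coaction_comp_map_counit G adj α b
      refine (congrArg (_ ≫ ·) (G.map_id _)).trans ((comp_id _).trans ?_)
      exact h.trans (id_comp _).symm))
    (fun f => Comonad.Coalgebra.Hom.ext ((comp_id (F.map f)).trans (id_comp (F.map f)).symm))

/-- The components of `t_K` as coalgebra morphisms `K(R(a)) ⟶ G(a)` into cofree coalgebras. -/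
def toCofree
    (hcounit : ∀ b : B, α.app b ≫ G.ε.app (F.obj b) = 𝟙 (F.obj b))
    (hcoassoc : ∀ b : B,
      α.app b ≫ G.δ.app (F.obj b) = α.app b ≫ (G : A ⥤ A).map (α.app b))
    (a : A) :
    (comparisonToCoalgebras G F α hcounit hcoassoc).obj (R.obj a) ⟶ G.cofree.obj a where
  f := α.app (R.obj a) ≫ (G : A ⥤ A).map (adj.counit.app a)
  h := by
    have h' := Comonad.delta_naturality A G (adj.counit.app a)
    change α.app (R.obj a) ≫ G.map (α.app (R.obj a) ≫ G.map (adj.counit.app a)) =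
      (α.app (R.obj a) ≫ G.map (adj.counit.app a)) ≫ G.δ.app a
    dsimp at h'
    rw [assoc, h', reassoc_of% (hcoassoc (R.obj a)), G.map_comp]

theorem Comonad.hom_cofree_ext {X : G.Coalgebra} {a : A} {f g : X ⟶ G.cofree.obj a}
    (h : f.f ≫ G.ε.app a = g.f ≫ G.ε.app a) : f = g :=
  (G.adj.homEquiv X a).symm.injective <| by
    rw [G.adj.homEquiv_counit, G.adj.homEquiv_counit]
    simpa using! h

theorem isIso_toCofree
    (hcounit : ∀ b : B, α.app b ≫ G.ε.app (F.obj b) = 𝟙 (F.obj b))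
    (hcoassoc : ∀ b : B,
      α.app b ≫ G.δ.app (F.obj b) = α.app b ≫ (G : A ⥤ A).map (α.app b))
    [(comparisonToCoalgebras G F α hcounit hcoassoc).IsEquivalence] (a : A) :
    IsIso (toCofree G adj α hcounit hcoassoc a) := by
  let K := comparisonToCoalgebras G F α hcounit hcoassoc
  let t : K.obj (R.obj a) ⟶ G.cofree.obj a := toCofree G adj α hcounit hcoassoc a
  have ht : t.f ≫ G.ε.app a = adj.counit.app a :=
    coaction_comp_map_counit_comp_ε G adj α hcounit a
  have hKt {b : B} (g : b ⟶ R.obj a) :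
      (K.map g ≫ t).f ≫ G.ε.app a = (adj.homEquiv b a).symm g := by
    rw [adj.homEquiv_counit]
    exact (assoc _ _ _).trans (congrArg (F.map g ≫ ·) ht)
  let e : K.obj (K.objPreimage (G.cofree.obj a)) ≅ G.cofree.obj a := K.objObjPreimageIso _
  let g : K.objPreimage (G.cofree.obj a) ⟶ R.obj a := adj.homEquiv _ _ (e.hom.f ≫ G.ε.app a)
  have hg : K.map g ≫ t = e.hom :=
    Comonad.hom_cofree_ext G ((hKt g).trans ((adj.homEquiv _ _).symm_apply_apply _))
  have hs : (e.inv ≫ K.map g) ≫ t = 𝟙 _ := by rw [assoc, hg, e.inv_hom_id]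
  refine ⟨e.inv ≫ K.map g, ?_, hs⟩
  obtain ⟨r, hr⟩ := K.map_surjective (t ≫ e.inv ≫ K.map g)
  have hrt : K.map r ≫ t = K.map (𝟙 _) ≫ t := by
    rw [hr, assoc, hs, comp_id, K.map_id, id_comp]
  have hr1 : r = 𝟙 _ := (adj.homEquiv _ _).symm.injective (by rw [← hKt, ← hKt, hrt])
  exact hr.symm.trans (by rw [hr1, K.map_id])

end

/-- Let `G` be a comonad on `A`, `F : B ⥤ A` a functor with right adjoint
`R` (via `adj`, with counit `σ`), and `K : B ⥤ A^G` the functor with `U^G ∘ K = F`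
determined by a left `G`-comodule structure `α : F ⟶ GF`, with induced comonad morphism
`t_K = Gσ ∘ αR : FR ⟶ G`. Then `K` is an equivalence of categories if and only if (i) `F`
is comonadic, and (ii) `t_K` is an isomorphism of comonads. -/
theorem comparison_isEquivalence_iff
    {A : Type*} {B : Type*} [Category A] [Category B]
    (G : Comonad A) (F : B ⥤ A) (R : A ⥤ B) (adj : F ⊣ R)
    (α : F ⟶ F ⋙ (G : A ⥤ A))
    (hcounit : ∀ b : B, α.app b ≫ G.ε.app (F.obj b) = 𝟙 (F.obj b))
    (hcoassoc : ∀ b : B,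
      α.app b ≫ G.δ.app (F.obj b) = α.app b ≫ (G : A ⥤ A).map (α.app b)) :
    (comparisonToCoalgebras G F α hcounit hcoassoc).IsEquivalence ↔
      ((Comonad.comparison adj).IsEquivalence ∧
        ∀ a : A, IsIso (α.app (R.obj a) ≫ (G : A ⥤ A).map (adj.counit.app a))) := by
  have hiso := comparisonCompCoalgebraFunctorIso G adj α hcounit hcoassoc
  have hequiv (ht : ∀ a : A, IsIso (α.app (R.obj a) ≫ (G : A ⥤ A).map (adj.counit.app a))) :=
    Comonad.coalgebraFunctorOfComonadHom_isEquivalence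
      (comonadHomOfCoaction G adj α hcounit hcoassoc) ht
  constructor
  · intro hK
    have ht (a : A) : IsIso (α.app (R.obj a) ≫ (G : A ⥤ A).map (adj.counit.app a)) :=
      have := isIso_toCofree G adj α hcounit hcoassoc a
      inferInstanceAs (IsIso (G.forget.map (toCofree G adj α hcounit hcoassoc a)))
    have := hequiv ht
    have := Functor.isEquivalence_of_iso hiso.symm
    exact ⟨Functor.isEquivalence_of_comp_right _ (Comonad.coalgebraFunctorOfComonadHom
      (comonadHomOfCoaction G adj α hcounit hcoassoc)), ht⟩
  · rintro ⟨_, ht⟩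
    have := hequiv ht
    exact Functor.isEquivalence_of_iso hiso
end

section
/- Let T = (T, m, e) be a monad and G = (G, δ, ε) a comonad on a category A with a mixed distributive law λ : TG → GT, and let g : 1 → G be a grouplike morphism of G. Then the induced comparison functor K_g : A → (A_T)^Ĝ, a ↦ ((T(a), m_a), λ_a ∘ T(g_a)), is an equivalence of categories if and only if (i) the free functor φ_T : A → A_T is comonadic, and (ii) for every T-module (a, h), the composite G(h) ∘ λ_a ∘ T(g_a) : T(a) → G(a) is an isomorphism. -/
open CategoryTheory Category

universe v u

variable {A : Type u} [Category.{v} A]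

/-- A mixed `λ`-bimodule (a `TG`-bimodule) for a monad `T` and a comonad `G` related by a
natural transformation `λ : TG ⟶ GT`: an object with a `T`-module structure and a
`G`-comodule structure satisfying the compatibility `θ ∘ h = G(h) ∘ λ ∘ T(θ)`.
The category of these is the Eilenberg–Moore category `(A_T)^Ĝ` of the lifted comonad. -/
structure MixedBimod (T : Monad A) (G : Comonad A)
    (lam : (G : A ⥤ A) ⋙ (T : A ⥤ A) ⟶ (T : A ⥤ A) ⋙ (G : A ⥤ A)) where
  pt : A
  act : (T : A ⥤ A).obj pt ⟶ pt
  coact : pt ⟶ (G : A ⥤ A).obj pt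
  unit : T.η.app pt ≫ act = 𝟙 pt
  assoc : T.μ.app pt ≫ act = (T : A ⥤ A).map act ≫ act
  counit : coact ≫ G.ε.app pt = 𝟙 pt
  coassoc : coact ≫ G.δ.app pt = coact ≫ (G : A ⥤ A).map coact
  compat : act ≫ coact = (T : A ⥤ A).map coact ≫ lam.app pt ≫ (G : A ⥤ A).map act

namespace MixedBimod

variable {T : Monad A} {G : Comonad A}
  {lam : (G : A ⥤ A) ⋙ (T : A ⥤ A) ⟶ (T : A ⥤ A) ⋙ (G : A ⥤ A)}

/-- A morphism of mixed bimodules: a morphism of the underlying objects which is both a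
morphism of `T`-modules and of `G`-comodules. -/
@[ext]
structure Hom (X Y : MixedBimod T G lam) where
  hom : X.pt ⟶ Y.pt
  mod : (T : A ⥤ A).map hom ≫ Y.act = X.act ≫ hom
  comod : hom ≫ Y.coact = X.coact ≫ (G : A ⥤ A).map hom

instance : Category (MixedBimod T G lam) where
  Hom X Y := Hom X Y
  id X :=
    { hom := 𝟙 X.pt
      mod := by simp
      comod := by simp }
  comp f g :=
    { hom := f.hom ≫ g.hom
      mod := by
        rw [Functor.map_comp, Category.assoc, g.mod, ← Category.assoc, f.mod,
          Category.assoc]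
      comod := by
        rw [Category.assoc, g.comod, ← Category.assoc, f.comod, Category.assoc,
          ← Functor.map_comp] }
  id_comp f := Hom.ext (Category.id_comp f.hom)
  comp_id f := Hom.ext (Category.comp_id f.hom)
  assoc f g h := Hom.ext (Category.assoc f.hom g.hom h.hom)

end MixedBimod

namespace MixedBimod

variable {T : Monad A} {G : Comonad A}
  {lam : (G : A ⥤ A) ⋙ (T : A ⥤ A) ⟶ (T : A ⥤ A) ⋙ (G : A ⥤ A)}

lemma hom_ext {X Y : MixedBimod T G lam} {f f' : X ⟶ Y} (w : f.hom = f'.hom) : f = f' :=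
  Hom.ext w

lemma obj_ext {X Y : MixedBimod T G lam} (hpt : X.pt = Y.pt) (hact : HEq X.act Y.act)
    (hcoact : HEq X.coact Y.coact) : X = Y := by
  cases X
  cases Y
  cases hpt
  cases hact
  cases hcoact
  rfl

lemma hom_heq {X X' Y Y' : MixedBimod T G lam} (hX : X = X') (hY : Y = Y')
    {f : X ⟶ Y} {f' : X' ⟶ Y'} (w : HEq f.hom f'.hom) : HEq f f' := by
  subst hX hY
  exact heq_of_eq (hom_ext (eq_of_heq w))

/-- The underlying `T`-module of a mixed bimodule. -/
def toAlgebra (X : MixedBimod T G lam) : T.Algebra where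
  A := X.pt
  a := X.act
  unit := X.unit
  assoc := X.assoc

end MixedBimod

namespace Entwining

variable {T : Monad A} {G : Comonad A}
  {lam : (G : A ⥤ A) ⋙ (T : A ⥤ A) ⟶ (T : A ⥤ A) ⋙ (G : A ⥤ A)}
  {g : 𝟭 A ⟶ (G : A ⥤ A)}

/-- The axioms of a mixed distributive law from a monad `T` to a comonad `G`. -/
structure IsEntwining (T : Monad A) (G : Comonad A)
    (lam : (G : A ⥤ A) ⋙ (T : A ⥤ A) ⟶ (T : A ⥤ A) ⋙ (G : A ⥤ A)) : Prop where
  mul (a : A) : T.μ.app (G.obj a) ≫ lam.app a =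
    T.map (lam.app a) ≫ lam.app (T.obj a) ≫ G.map (T.μ.app a)
  comul (a : A) : lam.app a ≫ G.δ.app (T.obj a) =
    T.map (G.δ.app a) ≫ lam.app (G.obj a) ≫ G.map (lam.app a)
  unit (a : A) : T.η.app (G.obj a) ≫ lam.app a = G.map (T.η.app a)
  counit (a : A) : lam.app a ≫ G.ε.app (T.obj a) = T.map (G.ε.app a)

/-- The axioms of a grouplike morphism of a comonad `G`. -/
structure IsGrouplike (G : Comonad A) (g : 𝟭 A ⟶ (G : A ⥤ A)) : Prop where
  counit (a : A) : g.app a ≫ G.ε.app a = 𝟙 a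
  comul (a : A) : g.app a ≫ G.δ.app a = g.app a ≫ G.map (g.app a)

lemma lam_naturality (lam : (G : A ⥤ A) ⋙ (T : A ⥤ A) ⟶ (T : A ⥤ A) ⋙ (G : A ⥤ A)) {a b : A}
    (f : a ⟶ b) : T.map (G.map f) ≫ lam.app b = lam.app a ≫ G.map (T.map f) :=
  lam.naturality f

lemma μ_naturality (T : Monad A) {a b : A} (f : a ⟶ b) :
    T.map (T.map f) ≫ T.μ.app b = T.μ.app a ≫ T.map f :=
  T.μ.naturality f

lemma δ_naturality (G : Comonad A) {a b : A} (f : a ⟶ b) :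
    G.map f ≫ G.δ.app b = G.δ.app a ≫ G.map (G.map f) :=
  G.δ.naturality f

lemma ε_naturality (G : Comonad A) {a b : A} (f : a ⟶ b) :
    G.map f ≫ G.ε.app b = G.ε.app a ≫ f :=
  G.ε.naturality f

/-- The cofree mixed bimodule on a `T`-module. -/
def cofree (hl : IsEntwining T G lam) (X : T.Algebra) : MixedBimod T G lam where
  pt := G.obj X.A
  act := lam.app X.A ≫ G.map X.a
  coact := G.δ.app X.A
  unit := by
    rw [reassoc_of% hl.unit X.A, ← Functor.map_comp, X.unit, CategoryTheory.Functor.map_id]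
  assoc := by
    rw [reassoc_of% hl.mul X.A, ← Functor.map_comp, X.assoc, Functor.map_comp, Functor.map_comp,
      assoc, reassoc_of% lam_naturality lam X.a]
  counit := G.left_counit X.A
  coassoc := (G.coassoc X.A).symm
  compat := by
    rw [assoc, δ_naturality, reassoc_of% hl.comul X.A, Functor.map_comp]

/-- The canonical morphism from the free module `T(a)` to `G(a)` for a `T`-module `a`. -/
def can (lam : (G : A ⥤ A) ⋙ (T : A ⥤ A) ⟶ (T : A ⥤ A) ⋙ (G : A ⥤ A))
    (g : 𝟭 A ⟶ (G : A ⥤ A)) {a : A} (h : T.obj a ⟶ a) : T.obj a ⟶ G.obj a :=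
  T.map (g.app a) ≫ lam.app a ≫ G.map h

lemma can_naturality {a b : A} {h : T.obj a ⟶ a} {k : T.obj b ⟶ b} {f : a ⟶ b}
    (w : T.map f ≫ k = h ≫ f) : T.map f ≫ can lam g k = can lam g h ≫ G.map f := by
  have natg : f ≫ g.app b = g.app a ≫ G.map f := g.naturality f
  simp only [can, assoc]
  rw [← Functor.map_comp_assoc, natg, Functor.map_comp_assoc, reassoc_of% lam_naturality lam f,
    ← Functor.map_comp, w, Functor.map_comp]

lemma can_counit (hl : IsEntwining T G lam) (hg : IsGrouplike G g) {a : A} (h : T.obj a ⟶ a) :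
    can lam g h ≫ G.ε.app a = h := by
  simp only [can, assoc]
  rw [ε_naturality, reassoc_of% hl.counit a, ← Functor.map_comp_assoc, hg.counit,
    CategoryTheory.Functor.map_id, id_comp]

lemma μ_can (hl : IsEntwining T G lam) {a : A} {h : T.obj a ⟶ a}
    (ha : T.μ.app a ≫ h = T.map h ≫ h) :
    T.μ.app a ≫ can lam g h = T.map (can lam g h) ≫ lam.app a ≫ G.map h := by
  have nat : T.map (T.map (g.app a)) ≫ T.μ.app (G.obj a) = T.μ.app a ≫ T.map (g.app a) :=
    μ_naturality T _
  simp only [can, Functor.map_comp, assoc]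
  rw [← reassoc_of% nat, reassoc_of% hl.mul a, ← Functor.map_comp, ha, Functor.map_comp,
    reassoc_of% lam_naturality lam h]

lemma can_comul (hl : IsEntwining T G lam) (hg : IsGrouplike G g) {a : A} (h : T.obj a ⟶ a) :
    can lam g h ≫ G.δ.app a = (T.map (g.app a) ≫ lam.app a) ≫ G.map (can lam g h) := by
  have nat : T.map (G.map (g.app a)) ≫ lam.app (G.obj a) = lam.app a ≫ G.map (T.map (g.app a)) :=
    lam_naturality lam _
  simp only [can, assoc]
  rw [δ_naturality, reassoc_of% hl.comul a, ← Functor.map_comp_assoc, hg.comul,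
    Functor.map_comp_assoc, reassoc_of% nat]
  simp only [Functor.map_comp]

lemma map_η_can (a : A) :
    T.map (T.η.app a) ≫ can lam g (T.μ.app a) = T.map (g.app a) ≫ lam.app a := by
  have natg : T.η.app a ≫ g.app (T.obj a) = g.app a ≫ G.map (T.η.app a) :=
    g.naturality (T.η.app a)
  have natl : T.map (G.map (T.η.app a)) ≫ lam.app (T.obj a) =
      lam.app a ≫ G.map (T.map (T.η.app a)) := lam_naturality lam (T.η.app a)
  have unit : T.map (T.η.app a) ≫ T.μ.app a = 𝟙 (T.obj a) := T.right_unit a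
  dsimp only [can]
  rw [← Functor.map_comp_assoc, natg, Functor.map_comp_assoc, reassoc_of% natl,
    ← Functor.map_comp, unit, CategoryTheory.Functor.map_id, comp_id]

section Coaction

variable {a : A} {h : T.obj a ⟶ a} (b : a ⟶ T.obj a)

lemma comp_can_comul (hl : IsEntwining T G lam) (hg : IsGrouplike G g) :
    (b ≫ can lam g h) ≫ G.δ.app a =
      (b ≫ T.map (T.η.app a)) ≫ can lam g (T.μ.app a) ≫ G.map (can lam g h) := by
  have e := map_η_can (lam := lam) (g := g) a
  simp only [assoc]
  rw [can_comul hl hg, reassoc_of% e, assoc]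

variable {b}

lemma comp_can_comp_map (hb : T.map b ≫ T.μ.app a = h ≫ b) :
    (b ≫ can lam g h) ≫ G.map (b ≫ can lam g h) =
      (b ≫ T.map b) ≫ can lam g (T.μ.app a) ≫ G.map (can lam g h) := by
  have e := can_naturality (lam := lam) (g := g) hb
  simp only [assoc, Functor.map_comp]
  rw [reassoc_of% e]

lemma map_comp_can (hl : IsEntwining T G lam) (ha : T.μ.app a ≫ h = T.map h ≫ h) :
    T.map (b ≫ can lam g h) ≫ lam.app a ≫ G.map h =
      (T.map b ≫ T.μ.app a) ≫ can lam g h := by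
  rw [Functor.map_comp_assoc, ← μ_can hl ha, assoc]

end Coaction

lemma adj_toComonad_ε_f (X : T.Algebra) : (T.adj.toComonad.ε.app X).f = X.a := by
  simp
  rfl

lemma adj_toComonad_δ_f (X : T.Algebra) :
    (T.adj.toComonad.δ.app X).f = T.map (T.η.app X.A) := by
  simp
  rfl

lemma comparison_adj_a_f (a : A) :
    ((Comonad.comparison T.adj).obj a).a.f = T.map (T.η.app a) := by
  simp
  rfl

/-- The functor from coalgebras of the comonad of the free-forgetful adjunction of `T` to mixed
bimodules, induced by the comonad morphism `can`. -/
def ofCoalgebra (hl : IsEntwining T G lam) (hg : IsGrouplike G g) :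
    T.adj.toComonad.Coalgebra ⥤ MixedBimod T G lam where
  obj Y :=
    let b : Y.A.A ⟶ T.obj Y.A.A := Y.a.f
    have hb : T.map b ≫ T.μ.app Y.A.A = Y.A.a ≫ b := Y.a.h
    { pt := Y.A.A
      act := Y.A.a
      coact := b ≫ can lam g Y.A.a
      unit := Y.A.unit
      assoc := Y.A.assoc
      counit := by
        rw [assoc, can_counit hl hg]
        exact (congrArg (b ≫ ·) (adj_toComonad_ε_f Y.A)).symm.trans
          (congrArg Monad.Algebra.Hom.f Y.counit)
      coassoc := by
        have coassoc : b ≫ T.map (T.η.app Y.A.A) = b ≫ T.map b :=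
          (congrArg (b ≫ ·) (adj_toComonad_δ_f Y.A)).symm.trans
            (congrArg Monad.Algebra.Hom.f Y.coassoc)
        rw [comp_can_comul b hl hg, comp_can_comp_map hb, coassoc]
      compat := by
        rw [map_comp_can hl Y.A.assoc, hb, assoc] }
  map {Y Z} f :=
    { hom := f.f.f
      mod := f.f.h
      comod := by
        let b : Y.A.A ⟶ T.obj Y.A.A := Y.a.f
        let c : Z.A.A ⟶ T.obj Z.A.A := Z.a.f
        let φ : Y.A.A ⟶ Z.A.A := f.f.f
        have h : b ≫ T.map φ = φ ≫ c := congrArg Monad.Algebra.Hom.f f.h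
        change φ ≫ c ≫ can lam g Z.A.a = (b ≫ can lam g Y.A.a) ≫ G.map φ
        rw [← reassoc_of% h, can_naturality f.f.h, assoc] }

instance (hl : IsEntwining T G lam) (hg : IsGrouplike G g) : (ofCoalgebra hl hg).Faithful where
  map_injective w := by
    ext
    exact congrArg MixedBimod.Hom.hom w

lemma full_ofCoalgebra (hl : IsEntwining T G lam) (hg : IsGrouplike G g)
    (hcan : ∀ X : T.Algebra, IsIso (can lam g X.a)) : (ofCoalgebra hl hg).Full where
  map_surjective {Y Z} f := by
    let b : Y.A.A ⟶ T.obj Y.A.A := Y.a.f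
    let c : Z.A.A ⟶ T.obj Z.A.A := Z.a.f
    let φ : Y.A.A ⟶ Z.A.A := f.hom
    have mod : T.map φ ≫ Z.A.a = Y.A.a ≫ φ := f.mod
    have comod : φ ≫ c ≫ can lam g Z.A.a = (b ≫ can lam g Y.A.a) ≫ G.map φ := f.comod
    have comod' : b ≫ T.map φ = φ ≫ c := by
      have := hcan Z.A
      rw [← cancel_mono (can lam g Z.A.a), assoc, assoc, can_naturality mod, comod, assoc]
    exact ⟨{ f := { f := φ, h := mod }, h := Monad.Algebra.Hom.ext comod' }, rfl⟩

lemma essSurj_ofCoalgebra (hl : IsEntwining T G lam) (hg : IsGrouplike G g)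
    (hcan : ∀ X : T.Algebra, IsIso (can lam g X.a)) : (ofCoalgebra hl hg).EssSurj where
  mem_essImage X := by
    have : IsIso (can lam g X.act) := hcan X.toAlgebra
    have : IsIso (can lam g (T.μ.app X.pt)) := hcan (T.free.obj X.pt)
    obtain ⟨b, hb⟩ : ∃ b : X.pt ⟶ T.obj X.pt, b ≫ can lam g X.act = X.coact :=
      ⟨X.coact ≫ inv (can lam g X.act), by simp⟩
    have mod : T.map b ≫ T.μ.app X.pt = X.act ≫ b := by
      rw [← cancel_mono (can lam g X.act), ← map_comp_can hl X.assoc, assoc, hb, X.compat]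
    have counit : b ≫ X.act = 𝟙 X.pt := by
      have h := X.counit
      rwa [← hb, assoc, can_counit hl hg] at h
    have coassoc : b ≫ T.map (T.η.app X.pt) = b ≫ T.map b := by
      rw [← cancel_mono (can lam g (T.μ.app X.pt) ≫ G.map (can lam g X.act)),
        ← comp_can_comul b hl hg, ← comp_can_comp_map mod, hb, X.coassoc]
    exact ⟨{ A := X.toAlgebra
             a := { f := b, h := mod }
             counit := Monad.Algebra.Hom.ext
               ((congrArg (b ≫ ·) (adj_toComonad_ε_f X.toAlgebra)).trans counit)
             coassoc := Monad.Algebra.Hom.ext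
               ((congrArg (b ≫ ·) (adj_toComonad_δ_f X.toAlgebra)).trans coassoc) },
      ⟨eqToIso (MixedBimod.obj_ext rfl HEq.rfl (heq_of_eq hb))⟩⟩

lemma isEquivalence_ofCoalgebra (hl : IsEntwining T G lam) (hg : IsGrouplike G g)
    (hcan : ∀ X : T.Algebra, IsIso (can lam g X.a)) : (ofCoalgebra hl hg).IsEquivalence where
  full := full_ofCoalgebra hl hg hcan
  essSurj := essSurj_ofCoalgebra hl hg hcan

/-- The comparison functor from the base category to mixed bimodules determined by a grouplike
morphism. -/
abbrev comparison (hl : IsEntwining T G lam) (hg : IsGrouplike G g) : A ⥤ MixedBimod T G lam :=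
  Comonad.comparison T.adj ⋙ ofCoalgebra hl hg

lemma comparison_coact (hl : IsEntwining T G lam) (hg : IsGrouplike G g) (a : A) :
    ((comparison hl hg).obj a).coact = T.map (g.app a) ≫ lam.app a :=
  (congrArg (· ≫ can lam g (T.μ.app a)) (comparison_adj_a_f a)).trans (map_η_can a)

/-- The morphism `can`, as a morphism of mixed bimodules to the cofree one. -/
def canHom (hl : IsEntwining T G lam) (hg : IsGrouplike G g) (X : T.Algebra) :
    (comparison hl hg).obj X.A ⟶ cofree hl X where
  hom := can lam g X.a
  mod := (μ_can hl X.assoc).symm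
  comod := by
    rw [comparison_coact]
    exact can_comul hl hg X.a

lemma cofree_hom_ext {hl : IsEntwining T G lam} {X : T.Algebra} {Y : MixedBimod T G lam}
    {p q : Y ⟶ cofree hl X} (w : p.hom ≫ G.ε.app X.A = q.hom ≫ G.ε.app X.A) : p = q := by
  have key (p : Y ⟶ cofree hl X) : p.hom = Y.coact ≫ G.map (p.hom ≫ G.ε.app X.A) := by
    let φ : Y.pt ⟶ G.obj X.A := p.hom
    have comod : φ ≫ G.δ.app X.A = Y.coact ≫ G.map φ := p.comod
    change φ = Y.coact ≫ G.map (φ ≫ G.ε.app X.A)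
    rw [Functor.map_comp, ← reassoc_of% comod, G.right_counit, comp_id]
  exact MixedBimod.hom_ext (by rw [key p, key q, w])

lemma exists_map_comp_canHom (hl : IsEntwining T G lam) (hg : IsGrouplike G g) {X : T.Algebra}
    {c : A} (p : (comparison hl hg).obj c ⟶ cofree hl X) :
    ∃ f : c ⟶ X.A, (comparison hl hg).map f ≫ canHom hl hg X = p := by
  let φ : T.obj c ⟶ G.obj X.A := p.hom
  let q : T.obj c ⟶ X.A := φ ≫ G.ε.app X.A
  have mod : T.map φ ≫ lam.app X.A ≫ G.map X.a = T.μ.app c ≫ φ := p.mod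
  have hq : T.map q ≫ X.a = T.μ.app c ≫ q := by
    dsimp only [q]
    rw [← reassoc_of% mod, ε_naturality, reassoc_of% hl.counit X.A, Functor.map_comp_assoc]
  have unit : T.map (T.η.app c) ≫ T.μ.app c = 𝟙 (T.obj c) := T.right_unit c
  refine ⟨T.η.app c ≫ q, cofree_hom_ext ?_⟩
  change (T.map (T.η.app c ≫ q) ≫ can lam g X.a) ≫ G.ε.app X.A = q
  rw [assoc, can_counit hl hg, Functor.map_comp_assoc, hq, reassoc_of% unit]

lemma eq_id_of_map_comp_canHom (hl : IsEntwining T G lam) (hg : IsGrouplike G g) {X : T.Algebra}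
    {f : X.A ⟶ X.A} (w : (comparison hl hg).map f ≫ canHom hl hg X = canHom hl hg X) :
    f = 𝟙 X.A := by
  have w' : T.map f ≫ can lam g X.a = can lam g X.a := congrArg MixedBimod.Hom.hom w
  have h := w' =≫ G.ε.app X.A
  rw [assoc, can_counit hl hg] at h
  have nat : f ≫ T.η.app X.A = T.η.app X.A ≫ T.map f := T.η.naturality f
  rw [← comp_id f, ← X.unit, reassoc_of% nat, h]

lemma isIso_can_of_isEquivalence (hl : IsEntwining T G lam) (hg : IsGrouplike G g)
    [(comparison hl hg).IsEquivalence] (X : T.Algebra) : IsIso (can lam g X.a) := by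
  let K := comparison hl hg
  let i := K.objObjPreimageIso (cofree hl X)
  obtain ⟨f, hf⟩ := exists_map_comp_canHom hl hg i.hom
  let s : cofree hl X ⟶ K.obj X.A := i.inv ≫ K.map f
  have hs : s ≫ canHom hl hg X = 𝟙 _ :=
    (assoc _ _ _).trans ((congrArg (i.inv ≫ ·) hf).trans i.inv_hom_id)
  obtain ⟨f', hf'⟩ := K.map_surjective (canHom hl hg X ≫ s)
  have hf'_id : f' = 𝟙 X.A := eq_id_of_map_comp_canHom hl hg (by
    change K.map f' ≫ canHom hl hg X = _
    rw [hf', assoc, hs, comp_id])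
  rw [hf'_id, K.map_id] at hf'
  exact ⟨s.hom, (congrArg MixedBimod.Hom.hom hf').symm, congrArg MixedBimod.Hom.hom hs⟩

theorem isEquivalence_comparison_iff (hl : IsEntwining T G lam) (hg : IsGrouplike G g) :
    (comparison hl hg).IsEquivalence ↔
      (Comonad.comparison T.adj).IsEquivalence ∧ ∀ X : T.Algebra, IsIso (can lam g X.a) := by
  constructor
  · intro hK
    have hcan := isIso_can_of_isEquivalence hl hg
    have := isEquivalence_ofCoalgebra hl hg hcan
    exact ⟨Functor.isEquivalence_of_comp_right _ (ofCoalgebra hl hg), hcan⟩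
  · rintro ⟨_, hcan⟩
    have := isEquivalence_ofCoalgebra hl hg hcan
    infer_instance

end Entwining

/-- Given a monad `T`, a comonad `G` and a mixed distributive law
`λ : TG ⟶ GT` on `A`, and a grouplike morphism `g : 1 ⟶ G`, the induced comparison
functor `K_g : A ⥤ (A_T)^Ĝ`, `a ↦ ((T(a), m_a), λ_a ∘ T(g_a))`, is an equivalence of
categories if and only if (i) the free functor `φ_T : A ⥤ A_T` is comonadic, and
(ii) for every `T`-module `(a, h)` the composite `G(h) ∘ λ_a ∘ T(g_a) : T(a) ⟶ G(a)` is
an isomorphism. -/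
theorem comparison_isEquivalence_iff_comonadic_and_iso
    (T : Monad A) (G : Comonad A)
    (lam : (G : A ⥤ A) ⋙ (T : A ⥤ A) ⟶ (T : A ⥤ A) ⋙ (G : A ⥤ A))
    (entw_m : ∀ a : A, T.μ.app (G.obj a) ≫ lam.app a =
      (T : A ⥤ A).map (lam.app a) ≫ lam.app (T.obj a) ≫ (G : A ⥤ A).map (T.μ.app a))
    (entw_δ : ∀ a : A, lam.app a ≫ G.δ.app (T.obj a) =
      (T : A ⥤ A).map (G.δ.app a) ≫ lam.app (G.obj a) ≫ (G : A ⥤ A).map (lam.app a))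
    (entw_e : ∀ a : A, T.η.app (G.obj a) ≫ lam.app a = (G : A ⥤ A).map (T.η.app a))
    (entw_ε : ∀ a : A, lam.app a ≫ G.ε.app (T.obj a) = (T : A ⥤ A).map (G.ε.app a))
    (g : 𝟭 A ⟶ (G : A ⥤ A))
    (hg_counit : ∀ a : A, g.app a ≫ G.ε.app a = 𝟙 a)
    (hg_comul : ∀ a : A, g.app a ≫ G.δ.app a = g.app a ≫ (G : A ⥤ A).map (g.app a))
    (K : A ⥤ MixedBimod T G lam)
    (hK_pt : ∀ a : A, (K.obj a).pt = T.obj a)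
    (hK_act : ∀ a : A, HEq (K.obj a).act (T.μ.app a))
    (hK_coact : ∀ a : A, HEq (K.obj a).coact ((T : A ⥤ A).map (g.app a) ≫ lam.app a))
    (hK_map : ∀ (a b : A) (f : a ⟶ b), HEq (K.map f).hom ((T : A ⥤ A).map f)) :
    K.IsEquivalence ↔
      ((Comonad.comparison T.adj).IsEquivalence ∧
        ∀ X : Monad.Algebra T,
          IsIso ((T : A ⥤ A).map (g.app X.A) ≫ lam.app X.A ≫ (G : A ⥤ A).map X.a)) := by
  have hl : Entwining.IsEntwining T G lam := ⟨entw_m, entw_δ, entw_e, entw_ε⟩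
  have hg : Entwining.IsGrouplike G g := ⟨hg_counit, hg_comul⟩
  have hobj (a : A) : K.obj a = (Entwining.comparison hl hg).obj a :=
    MixedBimod.obj_ext (hK_pt a) (hK_act a)
      ((hK_coact a).trans (heq_of_eq (Entwining.comparison_coact hl hg a).symm))
  have hK : K = Entwining.comparison hl hg :=
    Functor.hext hobj fun a b f => MixedBimod.hom_heq (hobj a) (hobj b) (hK_map a b f)
  rw [hK]
  exact Entwining.isEquivalence_comparison_iff hl hg
end

section
/- Let T = (T, m, e) be a monad and G = (G, δ, ε) a comonad on a category A with a mixed distributive law λ : TG → GT, and let g : 1 → G be a grouplike morphism of G. Then the composite G(h) ∘ λ_a ∘ T(g_a) : T(a) → G(a) is an isomorphism for every T-module (a, h) if and only if the composite G(m_a) ∘ λ_{T(a)} ∘ T(g_{T(a)}) : TT(a) → GT(a) is an isomorphism for every object a of A. -/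
open CategoryTheory Category

/-- A morphism of split coequalizer diagrams that is invertible on the parallel pairs is
invertible on the coequalizers. -/
theorem isIso_of_isSplitCoequalizer {C : Type*} [Category C] {X Y Z X' Y' Z' : C}
    {f g : X ⟶ Y} {π : Y ⟶ Z} {f' g' : X' ⟶ Y'} {π' : Y' ⟶ Z'}
    (s : IsSplitCoequalizer f g π) (s' : IsSplitCoequalizer f' g' π')
    (a : X ⟶ X') (b : Y ⟶ Y') (c : Z ⟶ Z') (ha : IsIso a) (hb : IsIso b)
    (hf : f ≫ b = a ≫ f') (hg : g ≫ b = a ≫ g') (hπ : π ≫ c = b ≫ π') : IsIso c := by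
  have hf' : f' ≫ inv b = inv a ≫ f := by
    rw [IsIso.comp_inv_eq, assoc, hf, IsIso.inv_hom_id_assoc]
  have hg' : g' ≫ inv b = inv a ≫ g := by
    rw [IsIso.comp_inv_eq, assoc, hg, IsIso.inv_hom_id_assoc]
  have key : π ≫ c ≫ s'.rightSection ≫ inv b ≫ π = π := by
    rw [reassoc_of% hπ, ← s'.leftSection_top_assoc, reassoc_of% hf', s.condition,
      ← reassoc_of% hg', s'.leftSection_bottom_assoc, IsIso.hom_inv_id_assoc]
  refine ⟨s'.rightSection ≫ inv b ≫ π, ?_, by simp [hπ]⟩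
  simpa using s.rightSection ≫= key

/-- A natural transformation between functors factoring through the forgetful functor of a monad
is invertible at every module as soon as it is invertible at the free ones. -/
theorem isIso_app_of_isIso_app_free {A B : Type*} [Category A] [Category B] {T : Monad A}
    {F H : A ⥤ B} (k : T.forget ⋙ F ⟶ T.forget ⋙ H)
    (hk : ∀ a : A, IsIso (k.app (T.free.obj a))) (X : T.Algebra) : IsIso (k.app X) :=
  isIso_of_isSplitCoequalizer ((Monad.beckSplitCoequalizer X).map F)
    ((Monad.beckSplitCoequalizer X).map H) (k.app (T.free.obj (T.obj X.A)))
    (k.app (T.free.obj X.A)) (k.app X) (hk _) (hk _)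
    (k.naturality (Monad.FreeCoequalizer.topMap X))
    (k.naturality (Monad.FreeCoequalizer.bottomMap X)) (k.naturality (Monad.FreeCoequalizer.π X))

/-- The transformation `G(h) ∘ λ_a ∘ T(g_a) : T(a) ⟶ G(a)`, natural in the `T`-module `(a, h)`. -/
def moduleComparison {A : Type*} [Category A] (T : Monad A) (G : A ⥤ A)
    (lam : G ⋙ (T : A ⥤ A) ⟶ (T : A ⥤ A) ⋙ G) (g : 𝟭 A ⟶ G) :
    T.forget ⋙ (T : A ⥤ A) ⟶ T.forget ⋙ G where
  app X := (T : A ⥤ A).map (g.app X.A) ≫ lam.app X.A ≫ G.map X.a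
  naturality X Y f := by
    have hg : f.f ≫ g.app Y.A = g.app X.A ≫ G.map f.f := g.naturality f.f
    have hlam : T.map (G.map f.f) ≫ lam.app Y.A = lam.app X.A ≫ G.map (T.map f.f) :=
      lam.naturality f.f
    change T.map f.f ≫ T.map (g.app Y.A) ≫ lam.app Y.A ≫ G.map Y.a =
      (T.map (g.app X.A) ≫ lam.app X.A ≫ G.map X.a) ≫ G.map f.f
    rw [← T.map_comp_assoc, hg, T.map_comp_assoc, reassoc_of% hlam, ← G.map_comp, f.h,
      G.map_comp, assoc, assoc]

/-- Given a monad `T`, a comonad `G` and a mixed distributive law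
`λ : TG ⟶ GT` on `A`, and a grouplike morphism `g : 1 ⟶ G`, the composite
`G(h) ∘ λ_a ∘ T(g_a) : T(a) ⟶ G(a)` is an isomorphism for every `T`-module `(a, h)` if
and only if the composite `G(m_a) ∘ λ_{T(a)} ∘ T(g_{T(a)}) : TT(a) ⟶ GT(a)` is an
isomorphism for every object `a` of `A`. -/
theorem iso_on_modules_iff_iso_on_free
    {A : Type*} [Category A] (T : Monad A) (G : Comonad A)
    (lam : (G : A ⥤ A) ⋙ (T : A ⥤ A) ⟶ (T : A ⥤ A) ⋙ (G : A ⥤ A))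
    (entw_m : ∀ a : A, T.μ.app (G.obj a) ≫ lam.app a =
      (T : A ⥤ A).map (lam.app a) ≫ lam.app (T.obj a) ≫ (G : A ⥤ A).map (T.μ.app a))
    (entw_δ : ∀ a : A, lam.app a ≫ G.δ.app (T.obj a) =
      (T : A ⥤ A).map (G.δ.app a) ≫ lam.app (G.obj a) ≫ (G : A ⥤ A).map (lam.app a))
    (entw_e : ∀ a : A, T.η.app (G.obj a) ≫ lam.app a = (G : A ⥤ A).map (T.η.app a))
    (entw_ε : ∀ a : A, lam.app a ≫ G.ε.app (T.obj a) = (T : A ⥤ A).map (G.ε.app a))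
    (g : 𝟭 A ⟶ (G : A ⥤ A))
    (hg_counit : ∀ a : A, g.app a ≫ G.ε.app a = 𝟙 a)
    (hg_comul : ∀ a : A, g.app a ≫ G.δ.app a = g.app a ≫ (G : A ⥤ A).map (g.app a)) :
    (∀ X : Monad.Algebra T,
        IsIso ((T : A ⥤ A).map (g.app X.A) ≫ lam.app X.A ≫ (G : A ⥤ A).map X.a)) ↔
      (∀ a : A,
        IsIso ((T : A ⥤ A).map (g.app (T.obj a)) ≫ lam.app (T.obj a)
          ≫ (G : A ⥤ A).map (T.μ.app a))) := by
  refine ⟨fun h a => h (T.free.obj a), fun h X => ?_⟩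
  exact isIso_app_of_isIso_app_free (moduleComparison T G lam g) h X
end

section
/- Let (H̲, H̄, λ) be a compatible monad-comonad triple on a category A, i.e. δ ∘ m = Hm ∘ λH ∘ Hδ. If ε ∘ m = ε ∘ Hε (that is, ε : H → 1 is compatible with the multiplication as an augmentation of the monad H̲), then m = Hε ∘ λ. -/
open CategoryTheory Category

universe v u

/-- A monad-comonad triple `(H̲, H̄, λ)` on a category `A`: an endofunctor `H` carrying a
monad structure `H̲ = (H, m, e)` and a comonad structure `H̄ = (H, δ, ε)`, together with
an entwining `λ : HH ⟶ HH` from the monad `H̲` to the comonad `H̄`, i.e. a natural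
transformation satisfying `λ ∘ mH = Hm ∘ λH ∘ Hλ`, `δH ∘ λ = Hλ ∘ λH ∘ Hδ`,
`λ ∘ eH = He`, and `εH ∘ λ = Hε`. -/
structure MonadComonadTriple (A : Type u) [Category.{v} A] where
  H : A ⥤ A
  m : H ⋙ H ⟶ H
  e : 𝟭 A ⟶ H
  δ : H ⟶ H ⋙ H
  ε : H ⟶ 𝟭 A
  lam : H ⋙ H ⟶ H ⋙ H
  m_assoc : ∀ a : A, H.map (m.app a) ≫ m.app a = m.app (H.obj a) ≫ m.app a
  left_unit : ∀ a : A, e.app (H.obj a) ≫ m.app a = 𝟙 (H.obj a)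
  right_unit : ∀ a : A, H.map (e.app a) ≫ m.app a = 𝟙 (H.obj a)
  δ_coassoc : ∀ a : A, δ.app a ≫ H.map (δ.app a) = δ.app a ≫ δ.app (H.obj a)
  left_counit : ∀ a : A, δ.app a ≫ ε.app (H.obj a) = 𝟙 (H.obj a)
  right_counit : ∀ a : A, δ.app a ≫ H.map (ε.app a) = 𝟙 (H.obj a)
  entwining_m : ∀ a : A, m.app (H.obj a) ≫ lam.app a
    = H.map (lam.app a) ≫ lam.app (H.obj a) ≫ H.map (m.app a)
  entwining_δ : ∀ a : A, lam.app a ≫ δ.app (H.obj a)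
    = H.map (δ.app a) ≫ lam.app (H.obj a) ≫ H.map (lam.app a)
  entwining_e : ∀ a : A, e.app (H.obj a) ≫ lam.app a = H.map (e.app a)
  entwining_ε : ∀ a : A, lam.app a ≫ ε.app (H.obj a) = H.map (ε.app a)

/-- Let `(H̲, H̄, λ)` be a compatible monad-comonad triple on `A`, i.e.
`δ ∘ m = Hm ∘ λH ∘ Hδ`. If `ε ∘ m = ε ∘ Hε` (that is, `ε : H ⟶ 1` is compatible with the
multiplication as an augmentation of the monad `H̲`), then `m = Hε ∘ λ`. -/
theorem mul_eq_Heps_comp_lam_of_compatible_of_augmentation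
    {A : Type u} [Category.{v} A] (t : MonadComonadTriple A)
    (hcompat : ∀ a : A, t.m.app a ≫ t.δ.app a
      = t.H.map (t.δ.app a) ≫ t.lam.app (t.H.obj a) ≫ t.H.map (t.m.app a))
    (haug : ∀ a : A, t.m.app a ≫ t.ε.app a = t.H.map (t.ε.app a) ≫ t.ε.app a) :
    ∀ a : A, t.m.app a = t.lam.app a ≫ t.H.map (t.ε.app a) := by
  intro a
  have h_nat : t.lam.app (t.H.obj a) ≫ t.H.map (t.H.map (t.ε.app a))
      = t.H.map (t.H.map (t.ε.app a)) ≫ t.lam.app a :=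
    (t.lam.naturality (t.ε.app a)).symm
  calc t.m.app a
      = (t.m.app a ≫ t.δ.app a) ≫ t.H.map (t.ε.app a) := by
        rw [assoc, t.right_counit]; exact (comp_id _).symm
    _ = t.H.map (t.δ.app a) ≫ t.lam.app (t.H.obj a) ≫
          t.H.map (t.m.app a ≫ t.ε.app a) := by
        rw [hcompat, t.H.map_comp]; simp only [assoc]
    _ = t.H.map (t.δ.app a) ≫ (t.lam.app (t.H.obj a) ≫ t.H.map (t.H.map (t.ε.app a))) ≫
          t.H.map (t.ε.app a) := by
        rw [haug, t.H.map_comp]; simp only [assoc]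
    _ = t.H.map (t.δ.app a ≫ t.H.map (t.ε.app a)) ≫ t.lam.app a ≫ t.H.map (t.ε.app a) := by
        rw [h_nat, t.H.map_comp]; simp only [assoc]
    _ = t.lam.app a ≫ t.H.map (t.ε.app a) := by
        rw [t.right_counit, t.H.map_id]; exact id_comp _
end

section
/- Let (H̲, H̄, λ) be a monad-comonad triple on a category A such that δ = λ ∘ He or m = Hε ∘ λ. If e : 1 → H is a componentwise monomorphism or ε : H → 1 is a componentwise epimorphism, then ε ∘ e = id. -/
open CategoryTheory Category

universe v u

/-- If `δ = λ ∘ He` or `m = Hε ∘ λ`, then `H(ε ∘ e) = id`. -/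
theorem MonadComonadTriple.map_unit_comp_counit
    {A : Type u} [Category.{v} A] (t : MonadComonadTriple A)
    (h : (∀ a : A, t.δ.app a = t.H.map (t.e.app a) ≫ t.lam.app a)
      ∨ (∀ a : A, t.m.app a = t.lam.app a ≫ t.H.map (t.ε.app a))) (a : A) :
    t.H.map (t.e.app a ≫ t.ε.app a) = 𝟙 (t.H.obj a) := by
  rw [Functor.map_comp]
  rcases h with h | h
  · rw [← t.left_counit a, h a, assoc, t.entwining_ε]
  · rw [← t.left_unit a, h a, ← t.entwining_e, assoc]

/-- Let `(H̲, H̄, λ)` be a monad-comonad triple on `A` such that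
`δ = λ ∘ He` or `m = Hε ∘ λ`. If `e : 1 ⟶ H` is a componentwise monomorphism or
`ε : H ⟶ 1` is a componentwise epimorphism, then `ε ∘ e = id`. -/
theorem counit_comp_unit_eq_id
    {A : Type u} [Category.{v} A] (t : MonadComonadTriple A)
    (h : (∀ a : A, t.δ.app a = t.H.map (t.e.app a) ≫ t.lam.app a)
      ∨ (∀ a : A, t.m.app a = t.lam.app a ≫ t.H.map (t.ε.app a)))
    (h' : (∀ a : A, Mono (t.e.app a)) ∨ (∀ a : A, Epi (t.ε.app a))) :
    ∀ a : A, t.e.app a ≫ t.ε.app a = 𝟙 a := by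
  intro a
  have hH := t.map_unit_comp_counit h a
  rcases h' with h' | h'
  · have := h' a
    have nat : (t.e.app a ≫ t.ε.app a) ≫ t.e.app a
        = t.e.app a ≫ t.H.map (t.e.app a ≫ t.ε.app a) :=
      t.e.naturality (t.e.app a ≫ t.ε.app a)
    rw [← cancel_mono (t.e.app a), nat, hH]
    exact (comp_id _).trans (id_comp _).symm
  · have := h' a
    have nat : t.H.map (t.e.app a ≫ t.ε.app a) ≫ t.ε.app a
        = t.ε.app a ≫ t.e.app a ≫ t.ε.app a :=
      t.ε.naturality (t.e.app a ≫ t.ε.app a)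
    rw [← cancel_epi (t.ε.app a), ← nat, hH]
    exact (id_comp _).trans (comp_id _).symm
end

section
/- Let (H̲, H̄, λ) be a monad-comonad triple on a category A. If m = Hε ∘ λ or δ = λ ∘ He, then λ is compatible, that is, δ ∘ m = Hm ∘ λH ∘ Hδ : HH → HH. -/
open CategoryTheory Category

universe v u

/-- Let `(H̲, H̄, λ)` be a monad-comonad triple on `A`. If
`m = Hε ∘ λ` or `δ = λ ∘ He`, then `λ` is compatible, that is,
`δ ∘ m = Hm ∘ λH ∘ Hδ : HH ⟶ HH`. -/
theorem compatible_of_mul_eq_or_comul_eq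
    {A : Type u} [Category.{v} A] (t : MonadComonadTriple A)
    (h : (∀ a : A, t.m.app a = t.lam.app a ≫ t.H.map (t.ε.app a))
      ∨ (∀ a : A, t.δ.app a = t.H.map (t.e.app a) ≫ t.lam.app a)) :
    ∀ a : A, t.m.app a ≫ t.δ.app a
      = t.H.map (t.δ.app a) ≫ t.lam.app (t.H.obj a) ≫ t.H.map (t.m.app a) := by
  intro a
  rcases h with h | h
  · have hδ := t.δ.naturality (t.ε.app a)
    have hl := t.entwining_δ a
    dsimp at hδ hl
    calc t.m.app a ≫ t.δ.app a
        = (t.lam.app a ≫ t.δ.app (t.H.obj a)) ≫ t.H.map (t.H.map (t.ε.app a)) := by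
          rw [h a, assoc, assoc]
          exact congrArg (t.lam.app a ≫ ·) hδ
      _ = _ := by
          rw [hl, h a, t.H.map_comp]
          simp only [assoc]
  · have hm := t.m.naturality (t.e.app a)
    have hl := t.entwining_m a
    dsimp at hm hl
    calc t.m.app a ≫ t.δ.app a
        = t.H.map (t.H.map (t.e.app a)) ≫ t.m.app (t.H.obj a) ≫ t.lam.app a := by
          rw [h a, ← assoc, ← assoc]
          exact congrArg (· ≫ t.lam.app a) hm.symm
      _ = _ := by
          rw [hl, h a, t.H.map_comp]
          simp only [assoc]
end

section
/- Let (H̲, H̄, λ) be a monad-comonad triple on a category A. Then δ = λ ∘ He if and only if λ is compatible (δ ∘ m = Hm ∘ λH ∘ Hδ) and δ ∘ e = He ∘ e. -/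
open CategoryTheory Category

universe v u

/-- Let `(H̲, H̄, λ)` be a monad-comonad triple on `A`. Then
`δ = λ ∘ He` if and only if `λ` is compatible (`δ ∘ m = Hm ∘ λH ∘ Hδ`) and
`δ ∘ e = He ∘ e`. -/
theorem comul_eq_iff_compatible_and_grouplike
    {A : Type u} [Category.{v} A] (t : MonadComonadTriple A) :
    (∀ a : A, t.δ.app a = t.H.map (t.e.app a) ≫ t.lam.app a) ↔
      ((∀ a : A, t.m.app a ≫ t.δ.app a
        = t.H.map (t.δ.app a) ≫ t.lam.app (t.H.obj a) ≫ t.H.map (t.m.app a))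
      ∧ (∀ a : A, t.e.app a ≫ t.δ.app a = t.e.app a ≫ t.H.map (t.e.app a))) := by
  constructor
  · intro h
    refine ⟨fun a => ?_, fun a => ?_⟩
    · have hm : t.H.map (t.H.map (t.e.app a)) ≫ t.m.app (t.H.obj a)
          = t.m.app a ≫ t.H.map (t.e.app a) := t.m.naturality (t.e.app a)
      rw [h a, Functor.map_comp, assoc]
      erw [← t.entwining_m a, reassoc_of% hm]
    · have he : t.e.app a ≫ t.e.app (t.H.obj a) = t.e.app a ≫ t.H.map (t.e.app a) :=
        t.e.naturality (t.e.app a)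
      rw [h a, ← reassoc_of% he, t.entwining_e]
  · rintro ⟨hcompat, hgroup⟩ a
    have hlam : t.H.map (t.H.map (t.e.app a)) ≫ t.lam.app (t.H.obj a)
        = t.lam.app a ≫ t.H.map (t.H.map (t.e.app a)) := t.lam.naturality (t.e.app a)
    calc t.δ.app a
        = t.H.map (t.e.app a) ≫ t.m.app a ≫ t.δ.app a := by
          rw [reassoc_of% (t.right_unit a)]
      _ = t.H.map (t.e.app a ≫ t.δ.app a) ≫ t.lam.app (t.H.obj a) ≫ t.H.map (t.m.app a) := by
          rw [hcompat a, Functor.map_comp, assoc]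
      _ = t.H.map (t.e.app a) ≫ t.lam.app a ≫
            t.H.map (t.H.map (t.e.app a) ≫ t.m.app a) := by
          rw [hgroup a, Functor.map_comp, Functor.map_comp, assoc]
          erw [reassoc_of% hlam]
      _ = t.H.map (t.e.app a) ≫ t.lam.app a := by
          rw [t.right_unit a, CategoryTheory.Functor.map_id]
          exact congrArg _ (comp_id _)
end

section
/- Let (H̲, H̄, λ) be a monad-comonad triple on a category A. Then m = Hε ∘ λ if and only if λ is compatible (δ ∘ m = Hm ∘ λH ∘ Hδ) and ε ∘ m = ε ∘ Hε. -/
open CategoryTheory Category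

universe v u

/-- Let `(H̲, H̄, λ)` be a monad-comonad triple on `A`. Then
`m = Hε ∘ λ` if and only if `λ` is compatible (`δ ∘ m = Hm ∘ λH ∘ Hδ`) and
`ε ∘ m = ε ∘ Hε`. -/
theorem mul_eq_iff_compatible_and_augmentation
    {A : Type u} [Category.{v} A] (t : MonadComonadTriple A) :
    (∀ a : A, t.m.app a = t.lam.app a ≫ t.H.map (t.ε.app a)) ↔
      ((∀ a : A, t.m.app a ≫ t.δ.app a
        = t.H.map (t.δ.app a) ≫ t.lam.app (t.H.obj a) ≫ t.H.map (t.m.app a))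
      ∧ (∀ a : A, t.m.app a ≫ t.ε.app a = t.H.map (t.ε.app a) ≫ t.ε.app a)) := by
  constructor
  · intro h
    refine ⟨fun a => ?_, fun a => ?_⟩
    · have hδ : t.H.map (t.ε.app a) ≫ t.δ.app a
          = t.δ.app (t.H.obj a) ≫ t.H.map (t.H.map (t.ε.app a)) := t.δ.naturality (t.ε.app a)
      have hm : t.H.map (t.m.app a)
          = t.H.map (t.lam.app a) ≫ t.H.map (t.H.map (t.ε.app a)) :=
        (congrArg t.H.map (h a)).trans (t.H.map_comp _ _)
      calc t.m.app a ≫ t.δ.app a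
          = (t.lam.app a ≫ t.H.map (t.ε.app a)) ≫ t.δ.app a := congrArg (· ≫ t.δ.app a) (h a)
        _ = t.lam.app a ≫ t.H.map (t.ε.app a) ≫ t.δ.app a := assoc _ _ _
        _ = t.lam.app a ≫ t.δ.app (t.H.obj a) ≫ t.H.map (t.H.map (t.ε.app a)) :=
          congrArg (t.lam.app a ≫ ·) hδ
        _ = (t.lam.app a ≫ t.δ.app (t.H.obj a)) ≫ t.H.map (t.H.map (t.ε.app a)) :=
          (assoc _ _ _).symm
        _ = (t.H.map (t.δ.app a) ≫ t.lam.app (t.H.obj a) ≫ t.H.map (t.lam.app a))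
              ≫ t.H.map (t.H.map (t.ε.app a)) :=
          congrArg (· ≫ t.H.map (t.H.map (t.ε.app a))) (t.entwining_δ a)
        _ = t.H.map (t.δ.app a) ≫ t.lam.app (t.H.obj a) ≫ t.H.map (t.lam.app a)
              ≫ t.H.map (t.H.map (t.ε.app a)) :=
          (assoc _ _ _).trans (congrArg (t.H.map (t.δ.app a) ≫ ·) (assoc _ _ _))
        _ = t.H.map (t.δ.app a) ≫ t.lam.app (t.H.obj a) ≫ t.H.map (t.m.app a) :=
          congrArg (fun f => t.H.map (t.δ.app a) ≫ t.lam.app (t.H.obj a) ≫ f) hm.symm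
    · have hε : t.H.map (t.ε.app a) ≫ t.ε.app a = t.ε.app (t.H.obj a) ≫ t.ε.app a :=
        t.ε.naturality (t.ε.app a)
      calc t.m.app a ≫ t.ε.app a
          = (t.lam.app a ≫ t.H.map (t.ε.app a)) ≫ t.ε.app a := congrArg (· ≫ t.ε.app a) (h a)
        _ = t.lam.app a ≫ t.H.map (t.ε.app a) ≫ t.ε.app a := assoc _ _ _
        _ = t.lam.app a ≫ t.ε.app (t.H.obj a) ≫ t.ε.app a := congrArg (t.lam.app a ≫ ·) hε
        _ = (t.lam.app a ≫ t.ε.app (t.H.obj a)) ≫ t.ε.app a := (assoc _ _ _).symm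
        _ = t.H.map (t.ε.app a) ≫ t.ε.app a := congrArg (· ≫ t.ε.app a) (t.entwining_ε a)
  · rintro ⟨hc, hε⟩ a
    have hlam : t.lam.app (t.H.obj a) ≫ t.H.map (t.H.map (t.ε.app a))
        = t.H.map (t.H.map (t.ε.app a)) ≫ t.lam.app a := (t.lam.naturality (t.ε.app a)).symm
    have hmε : t.H.map (t.m.app a) ≫ t.H.map (t.ε.app a)
        = t.H.map (t.H.map (t.ε.app a)) ≫ t.H.map (t.ε.app a) :=
      (t.H.map_comp _ _).symm.trans ((congrArg t.H.map (hε a)).trans (t.H.map_comp _ _))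
    have hδ : t.H.map (t.δ.app a) ≫ t.H.map (t.H.map (t.ε.app a)) = 𝟙 (t.H.obj (t.H.obj a)) :=
      (t.H.map_comp _ _).symm.trans ((congrArg t.H.map (t.right_counit a)).trans (t.H.map_id _))
    calc t.m.app a
        = t.m.app a ≫ t.δ.app a ≫ t.H.map (t.ε.app a) :=
          (comp_id _).symm.trans (congrArg (t.m.app a ≫ ·) (t.right_counit a).symm)
      _ = (t.m.app a ≫ t.δ.app a) ≫ t.H.map (t.ε.app a) := (assoc _ _ _).symm
      _ = (t.H.map (t.δ.app a) ≫ t.lam.app (t.H.obj a) ≫ t.H.map (t.m.app a))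
            ≫ t.H.map (t.ε.app a) := congrArg (· ≫ t.H.map (t.ε.app a)) (hc a)
      _ = t.H.map (t.δ.app a) ≫ t.lam.app (t.H.obj a) ≫ t.H.map (t.m.app a)
            ≫ t.H.map (t.ε.app a) :=
          (assoc _ _ _).trans (congrArg (t.H.map (t.δ.app a) ≫ ·) (assoc _ _ _))
      _ = t.H.map (t.δ.app a) ≫ t.lam.app (t.H.obj a) ≫ t.H.map (t.H.map (t.ε.app a))
            ≫ t.H.map (t.ε.app a) :=
          congrArg (fun f => t.H.map (t.δ.app a) ≫ t.lam.app (t.H.obj a) ≫ f) hmε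
      _ = t.H.map (t.δ.app a) ≫ (t.lam.app (t.H.obj a) ≫ t.H.map (t.H.map (t.ε.app a)))
            ≫ t.H.map (t.ε.app a) :=
          congrArg (t.H.map (t.δ.app a) ≫ ·) (assoc _ _ _).symm
      _ = t.H.map (t.δ.app a) ≫ (t.H.map (t.H.map (t.ε.app a)) ≫ t.lam.app a)
            ≫ t.H.map (t.ε.app a) :=
          congrArg (fun f => t.H.map (t.δ.app a) ≫ f ≫ t.H.map (t.ε.app a)) hlam
      _ = (t.H.map (t.δ.app a) ≫ t.H.map (t.H.map (t.ε.app a)))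
            ≫ t.lam.app a ≫ t.H.map (t.ε.app a) :=
          (congrArg (t.H.map (t.δ.app a) ≫ ·) (assoc _ _ _)).trans (assoc _ _ _).symm
      _ = t.lam.app a ≫ t.H.map (t.ε.app a) :=
          (congrArg (· ≫ t.lam.app a ≫ t.H.map (t.ε.app a)) hδ).trans (id_comp _)
end

section
/- Let (H̲, H̄, λ) be a monad-comonad triple on a category A with δ = λ ∘ He and m = Hε ∘ λ, and assume that e : 1 → H is a componentwise monomorphism or ε : H → 1 is a componentwise epimorphism. Then (H̲, H̄, λ) is a bimonad: λ is compatible (δ ∘ m = Hm ∘ λH ∘ Hδ) and moreover ε ∘ m = ε ∘ Hε, δ ∘ e = He ∘ e, and ε ∘ e = id. -/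
open CategoryTheory Category

universe v u

/-- Let `(H̲, H̄, λ)` be a monad-comonad triple on `A` with
`δ = λ ∘ He` and `m = Hε ∘ λ`, and assume that `e : 1 ⟶ H` is a componentwise
monomorphism or `ε : H ⟶ 1` is a componentwise epimorphism. Then `(H̲, H̄, λ)` is a
bimonad: `λ` is compatible (`δ ∘ m = Hm ∘ λH ∘ Hδ`) and moreover `ε ∘ m = ε ∘ Hε`,
`δ ∘ e = He ∘ e`, and `ε ∘ e = id`. -/
theorem bimonad_of_comul_eq_and_mul_eq
    {A : Type u} [Category.{v} A] (t : MonadComonadTriple A)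
    (hδ : ∀ a : A, t.δ.app a = t.H.map (t.e.app a) ≫ t.lam.app a)
    (hm : ∀ a : A, t.m.app a = t.lam.app a ≫ t.H.map (t.ε.app a))
    (h' : (∀ a : A, Mono (t.e.app a)) ∨ (∀ a : A, Epi (t.ε.app a))) :
    (∀ a : A, t.m.app a ≫ t.δ.app a
      = t.H.map (t.δ.app a) ≫ t.lam.app (t.H.obj a) ≫ t.H.map (t.m.app a))
    ∧ (∀ a : A, t.m.app a ≫ t.ε.app a = t.H.map (t.ε.app a) ≫ t.ε.app a)
    ∧ (∀ a : A, t.e.app a ≫ t.δ.app a = t.e.app a ≫ t.H.map (t.e.app a))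
    ∧ (∀ a : A, t.e.app a ≫ t.ε.app a = 𝟙 a) := by
  have mul_counit : ∀ a : A, t.m.app a ≫ t.ε.app a = t.H.map (t.ε.app a) ≫ t.ε.app a := by
    intro a
    have nat : t.H.map (t.ε.app a) ≫ t.ε.app a = t.ε.app (t.H.obj a) ≫ t.ε.app a :=
      t.ε.naturality (t.ε.app a)
    rw [hm, assoc, nat, ← assoc, t.entwining_ε, nat]
  have unit_comul : ∀ a : A, t.e.app a ≫ t.δ.app a = t.e.app a ≫ t.H.map (t.e.app a) := by
    intro a
    have nat : t.e.app a ≫ t.e.app (t.H.obj a) = t.e.app a ≫ t.H.map (t.e.app a) :=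
      t.e.naturality (t.e.app a)
    rw [hδ, ← assoc, ← nat, assoc, t.entwining_e, nat]
  refine ⟨fun a => ?_, mul_counit, unit_comul, fun a => ?_⟩
  · have nat : t.H.map (t.ε.app a) ≫ t.δ.app a
        = t.δ.app (t.H.obj a) ≫ t.H.map (t.H.map (t.ε.app a)) := t.δ.naturality (t.ε.app a)
    calc t.m.app a ≫ t.δ.app a
        = (t.lam.app a ≫ t.δ.app (t.H.obj a)) ≫ t.H.map (t.H.map (t.ε.app a)) := by
          rw [hm, assoc, nat, ← assoc]
      _ = t.H.map (t.δ.app a) ≫ t.lam.app (t.H.obj a) ≫ t.H.map (t.lam.app a)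
            ≫ t.H.map (t.H.map (t.ε.app a)) := by
          rw [t.entwining_δ, assoc, assoc]
      _ = t.H.map (t.δ.app a) ≫ t.lam.app (t.H.obj a) ≫ t.H.map (t.m.app a) := by
          rw [← t.H.map_comp, ← hm]
  · rcases h' with mono_unit | epi_counit
    · have nat_e : t.e.app a ≫ t.e.app (t.H.obj a) = t.e.app a ≫ t.H.map (t.e.app a) :=
        t.e.naturality (t.e.app a)
      have nat_ε : t.ε.app a ≫ t.e.app a = t.e.app (t.H.obj a) ≫ t.H.map (t.ε.app a) :=
        t.e.naturality (t.ε.app a)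
      have := mono_unit a
      refine (cancel_mono (t.e.app a)).1 ?_
      calc (t.e.app a ≫ t.ε.app a) ≫ t.e.app a
          = (t.e.app a ≫ t.δ.app a) ≫ t.H.map (t.ε.app a) := by
            rw [assoc, nat_ε, ← assoc, nat_e, unit_comul]
        _ = 𝟙 a ≫ t.e.app a := by
            rw [assoc, t.right_counit]
            exact (comp_id _).trans (id_comp _).symm
    · have nat_e : t.H.map (t.e.app a) ≫ t.ε.app (t.H.obj a) = t.ε.app a ≫ t.e.app a :=
        t.ε.naturality (t.e.app a)
      have nat_ε : t.H.map (t.ε.app a) ≫ t.ε.app a = t.ε.app (t.H.obj a) ≫ t.ε.app a :=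
        t.ε.naturality (t.ε.app a)
      have := epi_counit a
      refine (cancel_epi (t.ε.app a)).1 ?_
      calc t.ε.app a ≫ t.e.app a ≫ t.ε.app a
          = t.H.map (t.e.app a) ≫ t.m.app a ≫ t.ε.app a := by
            rw [mul_counit, nat_ε, ← assoc, ← nat_e, assoc]
        _ = t.ε.app a ≫ 𝟙 a := by
            rw [← assoc, t.right_unit]
            exact (id_comp _).trans (comp_id _).symm
end

section
/- Let (H̲, H̄, λ) be a monad-comonad triple on a Cauchy complete category A (i.e. all idempotents split in A). Assume δ = λ ∘ He and that e : 1 → H is a componentwise monomorphism. Then the following are equivalent: (a) the comparison functor K_e : A → (A_{H̲})^{Ĥ̄}, a ↦ ((H(a), m_a), δ_a), is an equivalence of categories; (b) for every H̲-module (a, h), the composite H(h) ∘ δ_a : H(a) → H(a) is an isomorphism; (c) the composite Hm ∘ δH : HH → HH is an isomorphism. -/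
open CategoryTheory Category

universe v u

/-- A (mixed) `λ`-bimodule for a monad-comonad triple `t = (H̲, H̄, λ)`: an object with an
`H̲`-module structure and an `H̄`-comodule structure satisfying the compatibility
`θ ∘ h = H(h) ∘ λ ∘ H(θ)`. The category of these is the Eilenberg–Moore category
`(A_{H̲})^{Ĥ̄}` of the comonad `Ĥ̄` on `A_{H̲}` lifting `H̄` along `λ`. -/
structure TripleBimod {A : Type u} [Category.{v} A] (t : MonadComonadTriple A) where
  pt : A
  act : t.H.obj pt ⟶ pt
  coact : pt ⟶ t.H.obj pt
  unit : t.e.app pt ≫ act = 𝟙 pt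
  assoc : t.m.app pt ≫ act = t.H.map act ≫ act
  counit : coact ≫ t.ε.app pt = 𝟙 pt
  coassoc : coact ≫ t.δ.app pt = coact ≫ t.H.map coact
  compat : act ≫ coact = t.H.map coact ≫ t.lam.app pt ≫ t.H.map act

namespace TripleBimod

variable {A : Type u} [Category.{v} A] {t : MonadComonadTriple A}

/-- A morphism of `λ`-bimodules: a morphism of the underlying objects which is both a
morphism of `H̲`-modules and of `H̄`-comodules. -/
@[ext]
structure Hom (X Y : TripleBimod t) where
  hom : X.pt ⟶ Y.pt
  mod : t.H.map hom ≫ Y.act = X.act ≫ hom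
  comod : hom ≫ Y.coact = X.coact ≫ t.H.map hom

instance : Category (TripleBimod t) where
  Hom X Y := Hom X Y
  id X :=
    { hom := 𝟙 X.pt
      mod := by simp
      comod := by simp }
  comp f g :=
    { hom := f.hom ≫ g.hom
      mod := by
        rw [Functor.map_comp, Category.assoc, g.mod, ← Category.assoc, f.mod,
          Category.assoc]
      comod := by
        rw [Category.assoc, g.comod, ← Category.assoc, f.comod, Category.assoc,
          ← Functor.map_comp] }
  id_comp f := Hom.ext (Category.id_comp f.hom)
  comp_id f := Hom.ext (Category.comp_id f.hom)
  assoc f g h := Hom.ext (Category.assoc f.hom g.hom h.hom)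

end TripleBimod

namespace MonadComonadTriple

variable {A : Type u} [Category.{v} A] {t : MonadComonadTriple A}

section

variable (t)

/-- The unit `e`, with its source stated as `a` rather than `(𝟭 A).obj a`. -/
def η (a : A) : a ⟶ t.H.obj a := t.e.app a

/-- The multiplication `m`, with its source stated without composite functors. -/
def μ (a : A) : t.H.obj (t.H.obj a) ⟶ t.H.obj a := t.m.app a

/-- The comultiplication `δ`, with its target stated without composite functors. -/
def Δ (a : A) : t.H.obj a ⟶ t.H.obj (t.H.obj a) := t.δ.app a

/-- The counit `ε`, with its target stated as `a` rather than `(𝟭 A).obj a`. -/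
def κ (a : A) : t.H.obj a ⟶ a := t.ε.app a

/-- The entwining `λ`, with source and target stated without composite functors. -/
def ent (a : A) : t.H.obj (t.H.obj a) ⟶ t.H.obj (t.H.obj a) := t.lam.app a

lemma μ_assoc (a : A) : t.H.map (t.μ a) ≫ t.μ a = t.μ (t.H.obj a) ≫ t.μ a :=
  t.m_assoc a

lemma η_μ (a : A) : t.η (t.H.obj a) ≫ t.μ a = 𝟙 (t.H.obj a) :=
  t.left_unit a

lemma map_η_μ (a : A) : t.H.map (t.η a) ≫ t.μ a = 𝟙 (t.H.obj a) :=
  t.right_unit a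

lemma Δ_coassoc (a : A) : t.Δ a ≫ t.H.map (t.Δ a) = t.Δ a ≫ t.Δ (t.H.obj a) :=
  t.δ_coassoc a

lemma Δ_κ (a : A) : t.Δ a ≫ t.κ (t.H.obj a) = 𝟙 (t.H.obj a) :=
  t.left_counit a

lemma Δ_map_κ (a : A) : t.Δ a ≫ t.H.map (t.κ a) = 𝟙 (t.H.obj a) :=
  t.right_counit a

lemma μ_ent (a : A) : t.μ (t.H.obj a) ≫ t.ent a =
    t.H.map (t.ent a) ≫ t.ent (t.H.obj a) ≫ t.H.map (t.μ a) :=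
  t.entwining_m a

lemma ent_Δ (a : A) : t.ent a ≫ t.Δ (t.H.obj a) =
    t.H.map (t.Δ a) ≫ t.ent (t.H.obj a) ≫ t.H.map (t.ent a) :=
  t.entwining_δ a

lemma η_ent (a : A) : t.η (t.H.obj a) ≫ t.ent a = t.H.map (t.η a) :=
  t.entwining_e a

lemma ent_κ (a : A) : t.ent a ≫ t.κ (t.H.obj a) = t.H.map (t.κ a) :=
  t.entwining_ε a

end

lemma μ_naturality {a b : A} (f : a ⟶ b) :
    t.H.map (t.H.map f) ≫ t.μ b = t.μ a ≫ t.H.map f :=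
  t.m.naturality f

lemma η_naturality {a b : A} (f : a ⟶ b) : f ≫ t.η b = t.η a ≫ t.H.map f :=
  t.e.naturality f

lemma Δ_naturality {a b : A} (f : a ⟶ b) :
    t.H.map f ≫ t.Δ b = t.Δ a ≫ t.H.map (t.H.map f) :=
  t.δ.naturality f

lemma κ_naturality {a b : A} (f : a ⟶ b) : t.H.map f ≫ t.κ b = t.κ a ≫ f :=
  t.ε.naturality f

lemma ent_naturality {a b : A} (f : a ⟶ b) :
    t.H.map (t.H.map f) ≫ t.ent b = t.ent a ≫ t.H.map (t.H.map f) :=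
  t.lam.naturality f

/-- If `δ = λ ∘ He` and `e` is componentwise monic, then `ε` is a retraction of `e`. -/
lemma η_κ (hδ : ∀ a : A, t.Δ a = t.H.map (t.η a) ≫ t.ent a)
    (hmono : ∀ a : A, Mono (t.η a)) (a : A) : t.η a ≫ t.κ a = 𝟙 a := by
  have hH : t.H.map (t.η a ≫ t.κ a) = 𝟙 _ := by
    rw [Functor.map_comp, ← t.ent_κ, ← Category.assoc, ← hδ, t.Δ_κ]
  have := hmono a
  rw [← cancel_mono (t.η a), η_naturality, hH, Category.id_comp, Category.comp_id]

lemma η_Δ (hδ : ∀ a : A, t.Δ a = t.H.map (t.η a) ≫ t.ent a) (a : A) :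
    t.η a ≫ t.Δ a = t.η a ≫ t.η (t.H.obj a) := by
  rw [hδ, ← Category.assoc, ← η_naturality, Category.assoc, t.η_ent, ← η_naturality]

lemma μ_Δ (hδ : ∀ a : A, t.Δ a = t.H.map (t.η a) ≫ t.ent a) (a : A) :
    t.μ a ≫ t.Δ a =
      t.H.map (t.Δ a) ≫ t.ent (t.H.obj a) ≫ t.H.map (t.μ a) := by
  rw [hδ, ← Category.assoc, ← μ_naturality, Category.assoc, t.μ_ent,
    Functor.map_comp, Category.assoc]

variable (t) in
/-- The component at `h : H x ⟶ x` of the comonad morphism induced by the comparison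
functor. -/
def can {x : A} (h : t.H.obj x ⟶ x) : t.H.obj x ⟶ t.H.obj x :=
  t.Δ x ≫ t.H.map h

/-- `can` is natural with respect to module morphisms. -/
lemma can_naturality {x y : A} {h : t.H.obj x ⟶ x} {k : t.H.obj y ⟶ y} (f : x ⟶ y)
    (hf : t.H.map f ≫ k = h ≫ f) : t.H.map f ≫ t.can k = t.can h ≫ t.H.map f := by
  rw [can, can, reassoc_of% (Δ_naturality (t := t) f), ← Functor.map_comp, hf,
    Functor.map_comp, Category.assoc]

lemma can_κ {x : A} (h : t.H.obj x ⟶ x) : t.can h ≫ t.κ x = h := by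
  rw [can, Category.assoc, κ_naturality, ← Category.assoc, t.Δ_κ, Category.id_comp]

lemma η_can (hδ : ∀ a : A, t.Δ a = t.H.map (t.η a) ≫ t.ent a) {x : A}
    {h : t.H.obj x ⟶ x} (hu : t.η x ≫ h = 𝟙 x) : t.η x ≫ t.can h = t.η x := by
  rw [can, reassoc_of% (η_Δ hδ x), ← η_naturality, ← Category.assoc, hu, Category.id_comp]

lemma map_η_can_μ (a : A) : t.H.map (t.η a) ≫ t.can (t.μ a) = t.Δ a := by
  rw [can, reassoc_of% (Δ_naturality (t := t) (t.η a)), ← Functor.map_comp,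
    t.map_η_μ, CategoryTheory.Functor.map_id, Category.comp_id]

/-- `can` is a module morphism from the free module to the lifted comonad. -/
lemma μ_can (hδ : ∀ a : A, t.Δ a = t.H.map (t.η a) ≫ t.ent a) {x : A}
    {h : t.H.obj x ⟶ x} (ha : t.μ x ≫ h = t.H.map h ≫ h) :
    t.μ x ≫ t.can h = t.H.map (t.can h) ≫ t.ent x ≫ t.H.map h := by
  rw [can, reassoc_of% (μ_Δ hδ x), ← Functor.map_comp, ha, Functor.map_comp,
    Functor.map_comp, Category.assoc, reassoc_of% (ent_naturality (t := t) h)]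

/-- `can` is compatible with the comultiplications. -/
lemma can_Δ {x : A} (h : t.H.obj x ⟶ x) :
    t.can h ≫ t.Δ x = t.Δ x ≫ t.H.map (t.can h) := by
  rw [can, Category.assoc, Δ_naturality, Functor.map_comp, reassoc_of% (t.Δ_coassoc x)]

/-- Invertibility of `can` on free modules implies it on all modules. -/
lemma isIso_can_of_free (hfree : ∀ a : A, IsIso (t.can (t.μ a))) {x : A}
    {h : t.H.obj x ⟶ x} (hu : t.η x ≫ h = 𝟙 x)
    (ha : t.μ x ≫ h = t.H.map h ≫ h) : IsIso (t.can h) := by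
  have := hfree x
  have := hfree (t.H.obj x)
  have hsec : t.H.map (t.η x) ≫ t.H.map h = 𝟙 _ := by
    rw [← Functor.map_comp, hu, CategoryTheory.Functor.map_id]
  have nh := can_naturality (t := t) h ha.symm
  have hcoeq : t.H.map (t.μ x) ≫ inv (t.can (t.μ x)) ≫ t.H.map h =
      t.H.map (t.H.map h) ≫ inv (t.can (t.μ x)) ≫ t.H.map h := by
    have n₁ := can_naturality (t := t) (t.μ x) (t.μ_assoc x)
    have n₂ := can_naturality (t := t) (t.H.map h) (μ_naturality h)
    rw [← cancel_epi (t.can (t.μ (t.H.obj x))), ← reassoc_of% n₁, ← reassoc_of% n₂,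
      IsIso.hom_inv_id_assoc, ← Functor.map_comp, ha, Functor.map_comp]
  have hinv : t.can h ≫ t.H.map (t.η x) ≫ inv (t.can (t.μ x)) ≫ t.H.map h =
      𝟙 _ := by
    have : IsSplitEpi (t.H.map h) := ⟨⟨_, hsec⟩⟩
    rw [← cancel_epi (t.H.map h), reassoc_of% nh, ← Functor.map_comp_assoc,
      η_naturality, Functor.map_comp_assoc, ← hcoeq, ← Functor.map_comp_assoc,
      t.η_μ, CategoryTheory.Functor.map_id, Category.id_comp, IsIso.hom_inv_id_assoc,
      Category.comp_id]
  refine ⟨_, hinv, ?_⟩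
  rw [Category.assoc, Category.assoc, nh, IsIso.inv_hom_id_assoc, hsec]

variable (t) in
/-- The comparison functor `K_e`, sending `a` to `((H a, m_a), δ_a)`. -/
def comparison (hδ : ∀ a : A, t.Δ a = t.H.map (t.η a) ≫ t.ent a) :
    A ⥤ TripleBimod t where
  obj a :=
    { pt := t.H.obj a
      act := t.μ a
      coact := t.Δ a
      unit := t.η_μ a
      assoc := (t.μ_assoc a).symm
      counit := t.Δ_κ a
      coassoc := (t.Δ_coassoc a).symm
      compat := μ_Δ hδ a }
  map f :=
    { hom := t.H.map f
      mod := μ_naturality f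
      comod := Δ_naturality f }
  map_id a := TripleBimod.Hom.ext (t.H.map_id a)
  map_comp f g := TripleBimod.Hom.ext (t.H.map_comp f g)

variable (t) in
/-- The cofree bimodule on a module `(x, h)`. -/
def cofree {x : A} (h : t.H.obj x ⟶ x)
    (hu : t.η x ≫ h = 𝟙 x) (ha : t.μ x ≫ h = t.H.map h ≫ h) : TripleBimod t where
  pt := t.H.obj x
  act := t.ent x ≫ t.H.map h
  coact := t.Δ x
  unit := by
    change t.η (t.H.obj x) ≫ t.ent x ≫ t.H.map h = 𝟙 _
    rw [reassoc_of% (t.η_ent x), ← Functor.map_comp, hu, CategoryTheory.Functor.map_id]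
  assoc := by
    change t.μ (t.H.obj x) ≫ t.ent x ≫ t.H.map h = _
    rw [reassoc_of% (t.μ_ent x), ← Functor.map_comp, ha, Functor.map_comp,
      Functor.map_comp, Category.assoc, reassoc_of% (ent_naturality (t := t) h)]
  counit := t.Δ_κ x
  coassoc := (t.Δ_coassoc x).symm
  compat := by
    change _ = t.H.map (t.Δ x) ≫ t.ent (t.H.obj x) ≫ _
    rw [Category.assoc, Δ_naturality, reassoc_of% (t.ent_Δ x), Functor.map_comp]

/-- `can` as a bimodule morphism. -/
def canHom (hδ : ∀ a : A, t.Δ a = t.H.map (t.η a) ≫ t.ent a) {x : A}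
    (h : t.H.obj x ⟶ x) (hu : t.η x ≫ h = 𝟙 x)
    (ha : t.μ x ≫ h = t.H.map h ≫ h) :
    TripleBimod.Hom ((t.comparison hδ).obj x) (t.cofree h hu ha) where
  hom := t.can h
  mod := (μ_can hδ ha).symm
  comod := can_Δ h

/-- Bimodule morphisms from `K_e b` to a cofree bimodule factor through `can`. -/
lemma eq_map_can {b x : A} {h : t.H.obj x ⟶ x} (g : t.H.obj b ⟶ t.H.obj x)
    (gm : t.H.map g ≫ t.ent x ≫ t.H.map h = t.μ b ≫ g)
    (gc : g ≫ t.Δ x = t.Δ b ≫ t.H.map g) :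
    g = t.H.map (t.η b ≫ g ≫ t.κ x) ≫ t.can h := by
  have hκ : t.H.map (t.η b ≫ g ≫ t.κ x) ≫ h = g ≫ t.κ x := by
    rw [Functor.map_comp, Functor.map_comp, ← t.ent_κ, Category.assoc, Category.assoc,
      Category.assoc, ← κ_naturality, reassoc_of% gm, reassoc_of% (t.map_η_μ b)]
  rw [can, reassoc_of% (Δ_naturality (t := t)), ← Functor.map_comp, hκ, Functor.map_comp,
    ← reassoc_of% gc, t.Δ_map_κ, Category.comp_id]

/-- If the comparison functor is an equivalence, `can` is invertible on every module. -/
lemma isIso_can_of_isEquivalence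
    (hδ : ∀ a : A, t.Δ a = t.H.map (t.η a) ≫ t.ent a)
    [(t.comparison hδ).IsEquivalence] {x : A} {h : t.H.obj x ⟶ x}
    (hu : t.η x ≫ h = 𝟙 x) (ha : t.μ x ≫ h = t.H.map h ≫ h) : IsIso (t.can h) := by
  let i := (t.comparison hδ).objObjPreimageIso (t.cofree h hu ha)
  let b := (t.comparison hδ).objPreimage (t.cofree h hu ha)
  let f : b ⟶ x := t.η b ≫ i.hom.hom ≫ t.κ x
  let q : (t.comparison hδ).obj x ⟶ t.cofree h hu ha := canHom hδ h hu ha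
  have hi : i.hom = (t.comparison hδ).map f ≫ q :=
    TripleBimod.Hom.ext (eq_map_can i.hom.hom i.hom.mod i.hom.comod)
  let r := i.inv ≫ (t.comparison hδ).map f
  have hr : r ≫ q = 𝟙 _ := by
    rw [Category.assoc, ← hi, i.inv_hom_id]
  have hq : q ≫ r = 𝟙 _ := by
    obtain ⟨g, hg⟩ := (t.comparison hδ).map_surjective (q ≫ r)
    have hgq : (t.comparison hδ).map g ≫ q = q := by
      rw [hg, Category.assoc, hr, Category.comp_id]
    have hgq' : t.H.map g ≫ t.can h = t.can h := congrArg TripleBimod.Hom.hom hgq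
    have hg₁ : g = 𝟙 x := by
      have := congrArg (fun k => t.η x ≫ k ≫ t.κ x) hgq'
      simpa only [Category.assoc, can_κ, ← reassoc_of% (η_naturality (t := t) g), hu,
        Category.comp_id] using this
    rw [← hg, hg₁, CategoryTheory.Functor.map_id]
  exact ⟨r.hom, congrArg TripleBimod.Hom.hom hq, congrArg TripleBimod.Hom.hom hr⟩

lemma comparison_faithful (hδ : ∀ a : A, t.Δ a = t.H.map (t.η a) ≫ t.ent a)
    (hmono : ∀ a : A, Mono (t.η a)) : (t.comparison hδ).Faithful where
  map_injective {a b} f g hfg := by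
    have hfg' : t.H.map f = t.H.map g := congrArg TripleBimod.Hom.hom hfg
    have := hmono b
    rw [← cancel_mono (t.η b), η_naturality, η_naturality, hfg']

lemma comparison_full (hδ : ∀ a : A, t.Δ a = t.H.map (t.η a) ≫ t.ent a)
    (hmono : ∀ a : A, Mono (t.η a)) (hfree : ∀ a : A, IsIso (t.can (t.μ a))) :
    (t.comparison hδ).Full where
  map_surjective {a b} g := by
    obtain ⟨g, gm, gc⟩ := g
    change t.H.obj a ⟶ t.H.obj b at g
    change t.H.map g ≫ t.μ b = t.μ a ≫ g at gm
    change g ≫ t.Δ b = t.Δ a ≫ t.H.map g at gc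
    have := hfree b
    obtain ⟨k, hk₀⟩ : ∃ k, t.η a ≫ g = k := ⟨_, rfl⟩
    have hg : g = t.H.map k ≫ t.μ b := by
      rw [← hk₀, Functor.map_comp, Category.assoc, gm, ← Category.assoc, t.map_η_μ,
        Category.id_comp]
    have hk : k ≫ t.η (t.H.obj b) = k ≫ t.H.map (t.η b) := by
      rw [← cancel_mono (t.can (t.μ b)), Category.assoc, Category.assoc, map_η_can_μ,
        η_can hδ (t.η_μ b), η_naturality, ← hk₀, Category.assoc, gc,
        reassoc_of% (η_Δ hδ a), Functor.map_comp, ← reassoc_of% (η_naturality (t := t))]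
    have hk' : (k ≫ t.κ b) ≫ t.η b = k := by
      rw [Category.assoc, η_naturality, reassoc_of% hk, ← Functor.map_comp,
        η_κ hδ hmono, CategoryTheory.Functor.map_id, Category.comp_id]
    refine ⟨k ≫ t.κ b, TripleBimod.Hom.ext ?_⟩
    change t.H.map (k ≫ t.κ b) = g
    rw [hg]
    conv_rhs => rw [← hk']
    rw [Functor.map_comp _ (k ≫ t.κ b), Category.assoc, t.map_η_μ, Category.comp_id]

lemma comparison_essSurj [IsIdempotentComplete A]
    (hδ : ∀ a : A, t.Δ a = t.H.map (t.η a) ≫ t.ent a)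
    (hmono : ∀ a : A, Mono (t.η a))
    (hcan : ∀ (x : A) (h : t.H.obj x ⟶ x), t.η x ≫ h = 𝟙 x →
      t.μ x ≫ h = t.H.map h ≫ h → IsIso (t.can h)) :
    (t.comparison hδ).EssSurj where
  mem_essImage X := by
    obtain ⟨x, h, θ, hu, ha, hc, hca, hcomp⟩ := X
    change t.η x ≫ h = 𝟙 x at hu
    change t.μ x ≫ h = t.H.map h ≫ h at ha
    change θ ≫ t.κ x = 𝟙 x at hc
    change θ ≫ t.Δ x = θ ≫ t.H.map θ at hca
    change h ≫ θ = t.H.map θ ≫ t.ent x ≫ t.H.map h at hcomp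
    have := hcan x h hu ha
    have := hcan _ (t.μ x) (t.η_μ x) (t.μ_assoc x).symm
    obtain ⟨s, hs⟩ : ∃ s, s ≫ t.can h = θ := ⟨θ ≫ inv (t.can h), by simp⟩
    have sh : s ≫ h = 𝟙 x := by
      rw [← can_κ h, ← Category.assoc, hs, hc]
    have smod : t.H.map s ≫ t.μ x = h ≫ s := by
      rw [← cancel_mono (t.can h), Category.assoc, Category.assoc, hs, hcomp,
        μ_can hδ ha, ← Functor.map_comp_assoc, hs]
    have sco : s ≫ t.H.map s = s ≫ t.H.map (t.η x) := by
      rw [← cancel_mono (t.can (t.μ x)), ← cancel_mono (t.H.map (t.can h))]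
      simp only [Category.assoc]
      rw [reassoc_of% (can_naturality (t := t) s smod), reassoc_of% hs,
        ← Functor.map_comp, hs, reassoc_of% (map_η_can_μ (t := t) x), ← can_Δ,
        reassoc_of% hs, hca]
    have sp : (s ≫ t.κ x) ≫ s = (s ≫ t.κ x) ≫ t.η x := by
      rw [Category.assoc, ← κ_naturality, reassoc_of% sco, κ_naturality, Category.assoc]
    obtain ⟨a, i, r, hir, hri⟩ := IsIdempotentComplete.idempotents_split x (s ≫ t.κ x)
      (by rw [← Category.assoc, sp, Category.assoc, η_κ hδ hmono, Category.comp_id])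
    have hi : i ≫ s = i ≫ t.η x := by
      rw [← hri, Category.assoc, Category.assoc] at sp
      simpa [reassoc_of% hir] using congrArg (i ≫ ·) sp
    have hiθ : i ≫ θ = i ≫ t.η x := by
      rw [← hs, reassoc_of% hi, η_can hδ hu]
    have fmod : t.H.map (t.H.map i ≫ h) ≫ h = t.μ a ≫ t.H.map i ≫ h := by
      rw [Functor.map_comp, Category.assoc, ← ha, reassoc_of% (μ_naturality (t := t) i)]
    have fcomod : (t.H.map i ≫ h) ≫ θ = t.Δ a ≫ t.H.map (t.H.map i ≫ h) := by
      rw [Category.assoc, hcomp, ← Functor.map_comp_assoc, hiθ, Functor.map_comp_assoc,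
        ← reassoc_of% (hδ x), reassoc_of% (Δ_naturality (t := t) i), Functor.map_comp]
    have gmod : t.H.map (s ≫ t.H.map r) ≫ t.μ a = h ≫ s ≫ t.H.map r := by
      rw [Functor.map_comp, Category.assoc, μ_naturality, reassoc_of% smod]
    have gcomod : (s ≫ t.H.map r) ≫ t.Δ a = θ ≫ t.H.map (s ≫ t.H.map r) := by
      rw [Category.assoc, Δ_naturality, ← hs, Functor.map_comp, Category.assoc,
        ← reassoc_of% (can_naturality (t := t) s smod), reassoc_of% sco,
        reassoc_of% (map_η_can_μ (t := t) x)]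
    let f : (t.comparison hδ).obj a ⟶ ⟨x, h, θ, hu, ha, hc, hca, hcomp⟩ :=
      ⟨t.H.map i ≫ h, fmod, fcomod⟩
    let g : (⟨x, h, θ, hu, ha, hc, hca, hcomp⟩ : TripleBimod t) ⟶ (t.comparison hδ).obj a :=
      ⟨s ≫ t.H.map r, gmod, gcomod⟩
    refine ⟨a, ⟨⟨f, g, TripleBimod.Hom.ext ?_, TripleBimod.Hom.ext ?_⟩⟩⟩
    · change (t.H.map i ≫ h) ≫ s ≫ t.H.map r = 𝟙 _
      rw [Category.assoc, ← reassoc_of% smod, ← Functor.map_comp_assoc, hi,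
        Functor.map_comp_assoc, reassoc_of% (t.map_η_μ x), ← Functor.map_comp, hir,
        CategoryTheory.Functor.map_id]
    · change (s ≫ t.H.map r) ≫ t.H.map i ≫ h = 𝟙 _
      rw [Category.assoc, ← Functor.map_comp_assoc, hri, Functor.map_comp_assoc,
        reassoc_of% sco, ← Functor.map_comp_assoc, η_κ hδ hmono, CategoryTheory.Functor.map_id,
        Category.id_comp, sh]

end MonadComonadTriple

namespace TripleBimod

variable {A : Type u} [Category.{v} A] {t : MonadComonadTriple A}

lemma ext_of_heq {X Y : TripleBimod t} (hpt : X.pt = Y.pt) (hact : HEq X.act Y.act)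
    (hcoact : HEq X.coact Y.coact) : X = Y := by
  cases X
  cases Y
  cases hpt
  cases hact
  cases hcoact
  rfl

lemma hom_heq {X X' Y Y' : TripleBimod t} (hX : X = X') (hY : Y = Y') {f : X ⟶ Y}
    {f' : X' ⟶ Y'} (hf : HEq f.hom f'.hom) : HEq f f' := by
  subst hX hY
  exact heq_of_eq (Hom.ext (eq_of_heq hf))

end TripleBimod

/-- Let `(H̲, H̄, λ)` be a monad-comonad triple on a Cauchy complete
category `A`, with `δ = λ ∘ He` and `e : 1 ⟶ H` a componentwise monomorphism. Then the
following are equivalent: (a) the comparison functor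
`K_e : A ⥤ (A_{H̲})^{Ĥ̄}`, `a ↦ ((H(a), m_a), δ_a)`, is an equivalence of categories;
(b) for every `H̲`-module `(x, h)`, the composite `H(h) ∘ δ_x : H(x) ⟶ H(x)` is an
isomorphism; (c) the composite `Hm ∘ δH : HH ⟶ HH` is an isomorphism. -/
theorem comparison_equivalence_tfae
    {A : Type u} [Category.{v} A] [IsIdempotentComplete A]
    (t : MonadComonadTriple A)
    (hδ : ∀ a : A, t.δ.app a = t.H.map (t.e.app a) ≫ t.lam.app a)
    (hmono : ∀ a : A, Mono (t.e.app a))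
    (K : A ⥤ TripleBimod t)
    (hK_pt : ∀ a : A, (K.obj a).pt = t.H.obj a)
    (hK_act : ∀ a : A, HEq (K.obj a).act (t.m.app a))
    (hK_coact : ∀ a : A, HEq (K.obj a).coact (t.δ.app a))
    (hK_map : ∀ (a b : A) (f : a ⟶ b), HEq (K.map f).hom (t.H.map f)) :
    (K.IsEquivalence ↔
      (∀ (x : A) (h : t.H.obj x ⟶ x), t.e.app x ≫ h = 𝟙 x →
        t.m.app x ≫ h = t.H.map h ≫ h → IsIso (t.δ.app x ≫ t.H.map h)))
    ∧ ((∀ (x : A) (h : t.H.obj x ⟶ x), t.e.app x ≫ h = 𝟙 x →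
        t.m.app x ≫ h = t.H.map h ≫ h → IsIso (t.δ.app x ≫ t.H.map h)) ↔
      (∀ a : A, IsIso (t.δ.app (t.H.obj a) ≫ t.H.map (t.m.app a)))) := by
  obtain rfl : K = t.comparison hδ := by
    have hobj : ∀ a, K.obj a = (t.comparison hδ).obj a := fun a =>
      TripleBimod.ext_of_heq (hK_pt a) (hK_act a) (hK_coact a)
    exact CategoryTheory.Functor.hext hobj fun a b f =>
      TripleBimod.hom_heq (hobj a) (hobj b) (hK_map a b f)
  refine ⟨⟨fun _ x h hu ha => MonadComonadTriple.isIso_can_of_isEquivalence hδ hu ha,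
    fun hcan => ?_⟩, fun hcan a => hcan _ _ (t.left_unit a) (t.m_assoc a).symm,
    fun hfree x h hu ha => MonadComonadTriple.isIso_can_of_free hfree hu ha⟩
  have hfaithful := MonadComonadTriple.comparison_faithful hδ hmono
  have hfull := MonadComonadTriple.comparison_full hδ hmono
    fun a => hcan _ _ (t.left_unit a) (t.m_assoc a).symm
  have hess := MonadComonadTriple.comparison_essSurj hδ hmono hcan
  exact { }
end

section
/- Let (H̲, H̄, λ) be a monad-comonad triple on a Cauchy complete category A (i.e. all idempotents split in A). Assume δ = λ ∘ He, that e : 1 → H is a componentwise monomorphism, that ε ∘ m = ε ∘ Hε (ε is an augmentation of the monad H̲), and that the composite Hm ∘ δH : HH → HH is an isomorphism. Then (H̲, H̄, λ) is a Hopf monad: it is a bimonad and there exists a natural transformation S : H → H (an antipode) such that m ∘ HS ∘ δ = e ∘ ε = m ∘ SH ∘ δ. -/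
open CategoryTheory Category

universe v u

namespace MonadComonadTriple

variable {A : Type u} [Category.{v} A] (t : MonadComonadTriple A)

/-- The fusion operator `Hm ∘ δH : HH ⟶ HH`. -/
def fusion : t.H ⋙ t.H ⟶ t.H ⋙ t.H where
  app a := t.δ.app (t.H.obj a) ≫ t.H.map (t.m.app a)
  naturality a b f := by
    have h₁ := t.δ.naturality (t.H.map f)
    have h₂ := t.m.naturality f
    simp only [Functor.comp_map] at h₁ h₂ ⊢
    rw [reassoc_of% h₁, assoc, ← t.H.map_comp, ← t.H.map_comp, h₂]

theorem fusion_app (a : A) :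
    t.fusion.app a = t.δ.app (t.H.obj a) ≫ t.H.map (t.m.app a) := rfl

theorem map_m_fusion (a : A) :
    t.H.map (t.m.app a) ≫ t.fusion.app a
      = t.fusion.app (t.H.obj a) ≫ t.H.map (t.m.app a) := by
  have h := t.δ.naturality (t.m.app a)
  simp only [Functor.comp_map, Functor.comp_obj] at h
  simp only [fusion_app, assoc]
  rw [reassoc_of% h, ← t.H.map_comp, ← t.H.map_comp, t.m_assoc]

theorem fusion_δ (a : A) :
    t.fusion.app a ≫ t.δ.app (t.H.obj a)
      = t.δ.app (t.H.obj a) ≫ t.H.map (t.fusion.app a) := by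
  have h := t.δ.naturality (t.m.app a)
  have h' := t.δ_coassoc (t.H.obj a)
  simp only [Functor.comp_map, Functor.comp_obj] at h h'
  simp only [fusion_app, assoc, t.H.map_comp]
  rw [h, reassoc_of% h']

theorem map_e_fusion (a : A) : t.H.map (t.e.app a) ≫ t.fusion.app a = t.δ.app a := by
  have h := t.δ.naturality (t.e.app a)
  simp only [Functor.comp_map, Functor.id_obj] at h
  rw [fusion_app, reassoc_of% h, ← t.H.map_comp, t.right_unit, t.H.map_id]
  exact comp_id _

theorem fusion_ε (a : A) : t.fusion.app a ≫ t.ε.app (t.H.obj a) = t.m.app a := by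
  have h := t.ε.naturality (t.m.app a)
  have h' := t.left_counit (t.H.obj a)
  simp only [Functor.id_map, Functor.comp_obj] at h h'
  rw [fusion_app, assoc, h, reassoc_of% h']

theorem map_e_ε (a : A) :
    t.H.map (t.e.app a) ≫ t.ε.app (t.H.obj a) = t.ε.app a ≫ t.e.app a :=
  t.ε.naturality (t.e.app a)

theorem e_δ (hδ : ∀ a : A, t.δ.app a = t.H.map (t.e.app a) ≫ t.lam.app a) (a : A) :
    t.e.app a ≫ t.δ.app a = t.e.app a ≫ t.H.map (t.e.app a) := by
  have h := t.e.naturality (t.e.app a)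
  simp only [Functor.id_map, Functor.id_obj] at h
  rw [hδ, ← reassoc_of% h, t.entwining_e]

theorem e_ε (hδ : ∀ a : A, t.δ.app a = t.H.map (t.e.app a) ≫ t.lam.app a)
    (a : A) [Mono (t.e.app a)] : t.e.app a ≫ t.ε.app a = 𝟙 a := by
  have h := t.e_δ hδ a =≫ t.ε.app (t.H.obj a)
  rw [assoc, assoc, t.left_counit, t.map_e_ε, comp_id] at h
  rw [← cancel_mono (t.e.app a), assoc]
  exact h.symm.trans (id_comp _).symm

theorem compatible (hδ : ∀ a : A, t.δ.app a = t.H.map (t.e.app a) ≫ t.lam.app a) (a : A) :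
    t.m.app a ≫ t.δ.app a
      = t.H.map (t.δ.app a) ≫ t.lam.app (t.H.obj a) ≫ t.H.map (t.m.app a) := by
  have h := t.m.naturality (t.e.app a)
  simp only [Functor.comp_map, Functor.id_obj] at h
  rw [hδ, ← reassoc_of% h, t.entwining_m, t.H.map_comp, assoc]

section Antipode

variable [IsIso t.fusion]

/-- The antipode `εH ∘ (Hm ∘ δH)⁻¹ ∘ He` of a triple whose fusion operator is invertible. -/
noncomputable def antipode : t.H ⟶ t.H where
  app a := t.H.map (t.e.app a) ≫ (inv t.fusion).app a ≫ t.ε.app (t.H.obj a)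
  naturality a b f := by
    have h₁ := t.e.naturality f
    have h₂ := (inv t.fusion).naturality f
    have h₃ := t.ε.naturality (t.H.map f)
    simp only [Functor.comp_map, Functor.id_map] at h₁ h₂ h₃
    rw [← t.H.map_comp_assoc, h₁, t.H.map_comp_assoc, reassoc_of% h₂, h₃]
    simp only [assoc]

theorem antipode_app (a : A) :
    t.antipode.app a
      = t.H.map (t.e.app a) ≫ (inv t.fusion).app a ≫ t.ε.app (t.H.obj a) := rfl

theorem fusion_inv_app (a : A) :
    t.fusion.app a ≫ (inv t.fusion).app a = 𝟙 (t.H.obj (t.H.obj a)) := by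
  rw [← NatTrans.comp_app, IsIso.hom_inv_id]
  rfl

theorem inv_fusion_app (a : A) :
    (inv t.fusion).app a ≫ t.fusion.app a = 𝟙 (t.H.obj (t.H.obj a)) := by
  rw [← NatTrans.comp_app, IsIso.inv_hom_id]
  rfl

theorem map_m_inv_fusion (a : A) :
    t.H.map (t.m.app a) ≫ (inv t.fusion).app a
      = (inv t.fusion).app (t.H.obj a) ≫ t.H.map (t.m.app a) := by
  rw [← cancel_mono (t.fusion.app a), assoc, assoc, t.map_m_fusion]
  erw [t.inv_fusion_app, reassoc_of% (t.inv_fusion_app)]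
  exact comp_id _

theorem inv_fusion_δ (a : A) :
    (inv t.fusion).app a ≫ t.δ.app (t.H.obj a)
      = t.δ.app (t.H.obj a) ≫ t.H.map ((inv t.fusion).app a) := by
  rw [← cancel_epi (t.fusion.app a), reassoc_of% (t.fusion_inv_app), ← assoc, t.fusion_δ, assoc]
  erw [← t.H.map_comp, t.fusion_inv_app, t.H.map_id]
  exact (comp_id _).symm

theorem antipode_m (a : A) :
    t.antipode.app (t.H.obj a) ≫ t.m.app a
      = (inv t.fusion).app a ≫ t.ε.app (t.H.obj a) := by
  have h := t.ε.naturality (t.m.app a)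
  have h' := t.map_m_inv_fusion a
  simp only [Functor.id_map, Functor.comp_obj] at h h'
  rw [antipode_app, assoc, assoc, ← h, ← reassoc_of% h', ← t.H.map_comp_assoc,
    t.left_unit]
  erw [t.H.map_id, id_comp]

theorem δ_antipode_m (a : A) :
    t.δ.app a ≫ t.antipode.app (t.H.obj a) ≫ t.m.app a = t.ε.app a ≫ t.e.app a := by
  rw [t.antipode_m, ← t.map_e_fusion, assoc, reassoc_of% (t.fusion_inv_app), t.map_e_ε]

theorem inv_fusion_app_eq (a : A) :
    (inv t.fusion).app a
      = t.δ.app (t.H.obj a) ≫ t.H.map (t.antipode.app (t.H.obj a) ≫ t.m.app a) := by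
  have h := t.inv_fusion_δ a =≫ t.H.map (t.ε.app (t.H.obj a))
  rw [assoc, t.right_counit, assoc, ← t.H.map_comp, ← t.antipode_m] at h
  exact (comp_id _).symm.trans h

theorem δ_map_antipode_m (a : A) :
    t.δ.app a ≫ t.H.map (t.antipode.app a) ≫ t.m.app a = t.ε.app a ≫ t.e.app a := by
  have h : (inv t.fusion).app a ≫ t.m.app a = t.ε.app (t.H.obj a) := by
    rw [← t.fusion_ε, reassoc_of% (t.inv_fusion_app)]
  have hd := t.δ.naturality (t.e.app a)
  have hS := t.antipode.naturality (t.e.app a)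
  simp only [Functor.comp_map, Functor.id_obj] at hd hS
  rw [← t.map_e_ε, ← h, t.inv_fusion_app_eq, assoc, reassoc_of% hd, ← t.H.map_comp_assoc,
    reassoc_of% hS, t.right_unit]
  erw [comp_id]

end Antipode

end MonadComonadTriple

/-- Let `(H̲, H̄, λ)` be a monad-comonad triple on a Cauchy complete
category `A`. Assume `δ = λ ∘ He`, that `e : 1 ⟶ H` is a componentwise monomorphism, that
`ε ∘ m = ε ∘ Hε` (`ε` is an augmentation of the monad `H̲`), and that the composite
`Hm ∘ δH : HH ⟶ HH` is an isomorphism. Then `(H̲, H̄, λ)` is a Hopf monad: it is a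
bimonad (`λ` is compatible, `ε ∘ m = ε ∘ Hε`, `δ ∘ e = He ∘ e`, `ε ∘ e = id`) and there
exists an antipode `S : H ⟶ H` with `m ∘ HS ∘ δ = e ∘ ε = m ∘ SH ∘ δ`. -/
theorem hopf_monad_of_comparison_equivalence
    {A : Type u} [Category.{v} A] [IsIdempotentComplete A]
    (t : MonadComonadTriple A)
    (hδ : ∀ a : A, t.δ.app a = t.H.map (t.e.app a) ≫ t.lam.app a)
    (hmono : ∀ a : A, Mono (t.e.app a))
    (haug : ∀ a : A, t.m.app a ≫ t.ε.app a = t.H.map (t.ε.app a) ≫ t.ε.app a)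
    (hiso : ∀ a : A, IsIso (t.δ.app (t.H.obj a) ≫ t.H.map (t.m.app a))) :
    ((∀ a : A, t.m.app a ≫ t.δ.app a
        = t.H.map (t.δ.app a) ≫ t.lam.app (t.H.obj a) ≫ t.H.map (t.m.app a))
      ∧ (∀ a : A, t.m.app a ≫ t.ε.app a = t.H.map (t.ε.app a) ≫ t.ε.app a)
      ∧ (∀ a : A, t.e.app a ≫ t.δ.app a = t.e.app a ≫ t.H.map (t.e.app a))
      ∧ (∀ a : A, t.e.app a ≫ t.ε.app a = 𝟙 a))
    ∧ ∃ S : t.H ⟶ t.H,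
        (∀ a : A, t.δ.app a ≫ t.H.map (S.app a) ≫ t.m.app a = t.ε.app a ≫ t.e.app a)
        ∧ (∀ a : A, t.δ.app a ≫ S.app (t.H.obj a) ≫ t.m.app a
            = t.ε.app a ≫ t.e.app a) := by
  have : ∀ a, IsIso (t.fusion.app a) := hiso
  have : IsIso t.fusion := NatIso.isIso_of_isIso_app t.fusion
  exact ⟨⟨t.compatible hδ, haug, t.e_δ hδ, fun a => t.e_ε hδ a⟩,
    t.antipode, t.δ_map_antipode_m, t.δ_antipode_m⟩
end
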